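/- Fix an integer n ≥ 2. There is a constant C = C(n) > 0 such that for all sufficiently large N, the average over f ∈ 𝒫⁰_{n,N} of the number of primes p ramified in ℚ_f/ℚ (equivalently, of primes p dividing D_{ℚ_f}) satisfies 𝔼_N( #{ p prime : p divides D_{ℚ_f} } ) ≤ log log N + C. -/

import Mathlib

/-!
Arithmetic statistics of families of integer `S_n`-polynomials (I. Viglino).

`𝒫_{n,N}` is the family of monic integer polynomials
`f(X) = X^n + a_{n-1}X^{n-1} + ⋯ + a_0` with `|a_i| ≤ N`, identified with their
coefficient vectors `a : Fin n → ℤ`, and `𝒫⁰_{n,N} ⊆ 𝒫_{n,N}` is the subfamily of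
`f` whose splitting field over `ℚ` has Galois group isomorphic to `S_n`.
-/

open Polynomial Finset Filter

attribute [local instance] Classical.propDecidable

noncomputable section

/-- The monic integer polynomial `X^n + a_{n-1}X^{n-1} + ⋯ + a_0`. -/
def intPoly (n : ℕ) (a : Fin n → ℤ) : Polynomial ℤ :=
  Polynomial.X ^ n + ∑ i : Fin n, Polynomial.C (a i) * Polynomial.X ^ (i : ℕ)

/-- The same polynomial viewed over `ℚ`. -/
def ratPoly (n : ℕ) (a : Fin n → ℤ) : Polynomial ℚ :=
  (intPoly n a).map (Int.castRingHom ℚ)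

/-- Coefficient vectors with entries in `{-N, …, N}`: the family `𝒫_{n,N}`. -/
def coeffBox (n N : ℕ) : Finset (Fin n → ℤ) :=
  Fintype.piFinset fun _ => Finset.Icc (-(N : ℤ)) (N : ℤ)

/-- `f` is an `S_n`-polynomial: the Galois group of its splitting field `K_f` over `ℚ`
is isomorphic to the symmetric group on `n` letters. -/
def IsSnPoly (n : ℕ) (a : Fin n → ℤ) : Prop :=
  Nonempty ((ratPoly n a).Gal ≃* Equiv.Perm (Fin n))

/-- The family `𝒫⁰_{n,N}` of `S_n`-polynomials, as a finset of coefficient vectors. -/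
def P0 (n N : ℕ) : Finset (Fin n → ℤ) :=
  (coeffBox n N).filter fun a => IsSnPoly n a

/-- `ℙ_N`, the uniform probability of an event in `𝒫⁰_{n,N}`. -/
def probN (n N : ℕ) (E : (Fin n → ℤ) → Prop) : ℝ :=
  (((P0 n N).filter E).card : ℝ) / ((P0 n N).card : ℝ)

/-- `𝔼_N`, the expectation of a real random variable on `𝒫⁰_{n,N}`. -/
def expN (n N : ℕ) (F : (Fin n → ℤ) → ℝ) : ℝ :=
  (∑ a ∈ P0 n N, F a) / ((P0 n N).card : ℝ)

/-- `π(x)`, the number of rational primes `≤ x`. -/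
def primePi (x : ℝ) : ℕ :=
  ((Finset.range (⌊x⌋₊ + 1)).filter Nat.Prime).card

/-- `g ∈ 𝔽_p[X]` has splitting type `r = (r_1, …, r_n)` — encoded by `r : Fin n → ℕ` where
`r i` is `r_{i+1}`, the number of factors of degree `i+1` —, i.e. `g` is a product of
distinct monic irreducible polynomials with exactly `r i` monic irreducible factors of
degree `i+1` for each `i`. -/
def SplitTypeOf {p : ℕ} (g : Polynomial (ZMod p)) {n : ℕ} (r : Fin n → ℕ) : Prop :=
  Squarefree g ∧ ∀ i : Fin n,
    Nat.card {h : Polynomial (ZMod p) // h.Monic ∧ Irreducible h ∧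
      h.natDegree = (i : ℕ) + 1 ∧ h ∣ g} = r i

/-- `f` has splitting type `r` modulo `p`. -/
def HasSplitType (n : ℕ) (r : Fin n → ℕ) (a : Fin n → ℤ) (p : ℕ) : Prop :=
  SplitTypeOf ((intPoly n a).map (Int.castRingHom (ZMod p))) r

/-- `π_{f,r}(x)`: the number of primes `p ≤ x` such that `f` has splitting type `r` mod `p`. -/
def countSplit (n : ℕ) (r : Fin n → ℕ) (a : Fin n → ℤ) (x : ℝ) : ℕ :=
  ((Finset.range (⌊x⌋₊ + 1)).filter fun p => p.Prime ∧ HasSplitType n r a p).card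

/-- `δ(r) = ∏_{i=1}^n 1/(i^{r_i}·r_i!)`. -/
def splitDelta (n : ℕ) (r : Fin n → ℕ) : ℝ :=
  ∏ i : Fin n, (1 : ℝ) / ((((i : ℕ) + 1) ^ (r i) * Nat.factorial (r i) : ℕ) : ℝ)

/-- `r_i` as a function of the index `i ≥ 1` (so `rget n r 1 = r_1`, etc.). -/
def rget (n : ℕ) (r : Fin n → ℕ) (i : ℕ) : ℕ :=
  if h : i - 1 < n then r ⟨i - 1, h⟩ else 0

/-- `C_r = δ(r)·r_2(r_2−1)(r_1+1)(r_1+2)/(2^{r_2+1}·r_1!·r_2!)`. -/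
def splitCr (n : ℕ) (r : Fin n → ℕ) : ℝ :=
  splitDelta n r *
    ((rget n r 2 : ℝ) * ((rget n r 2 : ℝ) - 1) *
      ((rget n r 1 : ℝ) + 1) * ((rget n r 1 : ℝ) + 2)) /
    ((2 : ℝ) ^ (rget n r 2 + 1) * (Nat.factorial (rget n r 1) : ℝ) *
      (Nat.factorial (rget n r 2) : ℝ))

/-- The discriminant `D'_{ℚ_f}` of the number field `ℚ_f = ℚ(α) ≃ ℚ[X]/(f)` generated by a
root `α` of `f` (with its sign; `D_{ℚ_f}` is its absolute value), or `0` if `f` is not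
irreducible over `ℚ`. -/
def fieldDisc (n : ℕ) (a : Fin n → ℤ) : ℤ :=
  if h : Irreducible (ratPoly n a) then
    haveI : Fact (Irreducible (ratPoly n a)) := ⟨h⟩
    haveI : CharZero (AdjoinRoot (ratPoly n a)) :=
      charZero_of_injective_algebraMap (algebraMap ℚ (AdjoinRoot (ratPoly n a))).injective
    haveI : FiniteDimensional ℚ (AdjoinRoot (ratPoly n a)) :=
      PowerBasis.finite (AdjoinRoot.powerBasis h.ne_zero)
    NumberField.discr (AdjoinRoot (ratPoly n a))
  else 0

section Mertens

/-- Upper bound in Mertens' first theorem. -/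
theorem sum_primes_log_div_le (N : ℕ) (hN : 1 ≤ N) :
    ∑ p ∈ (range (N + 1)).filter Nat.Prime, Real.log p / p ≤ Real.log N + Real.log 4 := by
  set S := (range (N + 1)).filter Nat.Prime with hS
  have hprime : ∀ p ∈ S, p.Prime := fun p hp => (mem_filter.mp hp).2
  have hN0 : (0 : ℝ) < N := by exact_mod_cast hN
  have hdvd : ∏ p ∈ S, p ^ (N / p) ∣ N.factorial := by
    refine Finset.prod_dvd_of_isRelPrime (fun p hp q hq hpq => ?_) fun p hp => ?_
    · exact Nat.coprime_iff_isRelPrime.mp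
        (Nat.coprime_pow_primes _ _ (hprime p hp) (hprime q hq) hpq)
    · have hp' := hprime p hp
      refine (hp'.pow_dvd_factorial_iff (Nat.lt_succ_self (Nat.log p N))).mpr ?_
      rcases Nat.eq_zero_or_pos (Nat.log p N) with h | h
      · have : N < p := by
          rcases Nat.log_eq_zero_iff.mp h with h | h
          · exact h
          · exact absurd h (not_le.mpr hp'.one_lt)
        simp [Nat.div_eq_of_lt this]
      · have := Finset.single_le_sum (f := fun i => N / p ^ i) (fun _ _ => Nat.zero_le _)
          (Finset.mem_Ico.mpr ⟨le_refl 1, by omega⟩ : 1 ∈ Ico 1 (Nat.log p N + 1))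
        simpa using this
  have hlog : ∑ p ∈ S, ((N / p : ℕ) : ℝ) * Real.log p ≤ N * Real.log N := by
    have h1 : ∏ p ∈ S, p ^ (N / p) ≤ N ^ N :=
      (Nat.le_of_dvd (Nat.factorial_pos _) hdvd).trans (Nat.factorial_le_pow N)
    have hpos : (0 : ℝ) < ∏ p ∈ S, (p : ℝ) ^ (N / p) :=
      Finset.prod_pos fun p hp => pow_pos (by exact_mod_cast (hprime p hp).pos) _
    have h2 : ∏ p ∈ S, (p : ℝ) ^ (N / p) ≤ (N : ℝ) ^ N := by exact_mod_cast h1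
    have h3 := Real.log_le_log hpos h2
    rw [Real.log_pow, Real.log_prod (fun p hp => by
      have := (hprime p hp).pos
      positivity)] at h3
    simpa [Real.log_pow] using h3
  have htheta : ∑ p ∈ S, Real.log p ≤ Real.log 4 * N := by
    have h := Chebyshev.theta_le_log4_mul_x hN0.le
    rw [Chebyshev.theta_eq_sum_Icc, Nat.floor_natCast] at h
    refine le_trans (le_of_eq ?_) h
    refine Finset.sum_congr ?_ fun _ _ => rfl
    ext p
    simp [hS]
  have hmain : N * ∑ p ∈ S, Real.log p / p ≤ N * (Real.log N + Real.log 4) := by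
    calc N * ∑ p ∈ S, Real.log p / p
        ≤ ∑ p ∈ S, (((N / p : ℕ) : ℝ) * Real.log p + Real.log p) := by
          rw [Finset.mul_sum]
          refine Finset.sum_le_sum fun p hp => ?_
          have hp' := hprime p hp
          have hlp : 0 ≤ Real.log p := Real.log_natCast_nonneg p
          have h1 : (N : ℝ) / p ≤ ((N / p : ℕ) : ℝ) + 1 := by
            rw [← Nat.floor_div_eq_div (K := ℝ)]
            exact (Nat.lt_floor_add_one _).le
          calc (N : ℝ) * (Real.log p / p) = (N / p) * Real.log p := by ring
            _ ≤ (((N / p : ℕ) : ℝ) + 1) * Real.log p := by gcongr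
            _ = _ := by ring
      _ ≤ N * (Real.log N + Real.log 4) := by
          rw [Finset.sum_add_distrib]
          linarith
  exact le_of_mul_le_mul_left hmain hN0

/-- Upper bound in Mertens' second theorem. -/
theorem exists_sum_primes_inv_le : ∃ C > (0 : ℝ), ∀ N : ℕ, 2 ≤ N →
    ∑ p ∈ (range (N + 1)).filter Nat.Prime, (1 / p : ℝ) ≤ Real.log (Real.log N) + C := by
  set A : ℕ → ℝ := fun N => ∑ p ∈ (range (N + 1)).filter Nat.Prime, Real.log p / p with hA
  set S : ℕ → ℝ := fun N => ∑ p ∈ (range (N + 1)).filter Nat.Prime, (1 / p : ℝ) with hS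
  set c := Real.log 4
  obtain ⟨K, hK⟩ : ∃ K, S 2 - A 2 / Real.log 2 ≤ Real.log (Real.log 2) - c / Real.log 2 + K :=
    ⟨_, le_of_eq (add_sub_cancel _ _).symm⟩
  have key : ∀ N : ℕ, 2 ≤ N →
      S N - A N / Real.log N ≤ Real.log (Real.log N) - c / Real.log N + K := by
    intro N hN
    induction N, hN using Nat.le_induction with
    | base => simpa using hK
    | succ N hN ih =>
      have hl : 0 < Real.log N := Real.log_pos (by exact_mod_cast hN)
      have hl' : 0 < Real.log ((N + 1 : ℕ) : ℝ) := Real.log_pos (by push_cast; norm_cast; omega)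
      have hll : Real.log N ≤ Real.log ((N + 1 : ℕ) : ℝ) :=
        Real.log_le_log (by positivity) (by push_cast; linarith)
      have hstep : S (N + 1) - A (N + 1) / Real.log ((N + 1 : ℕ) : ℝ)
          = S N - A N / Real.log ((N + 1 : ℕ) : ℝ) := by
        simp only [hS, hA]
        rw [Finset.range_add_one, Finset.filter_insert]
        split_ifs with hp
        · rw [Finset.sum_insert (by simp), Finset.sum_insert (by simp)]
          field_simp
          ring
        · rfl
      have hAN : A N ≤ Real.log N + c := sum_primes_log_div_le N (by omega)
      have hinv : 0 ≤ 1 / Real.log N - 1 / Real.log ((N + 1 : ℕ) : ℝ) :=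
        sub_nonneg.mpr (one_div_le_one_div_of_le hl hll)
      have h1 := mul_le_mul_of_nonneg_right hAN hinv
      have h2 : 1 - Real.log N / Real.log ((N + 1 : ℕ) : ℝ) ≤
          Real.log (Real.log ((N + 1 : ℕ) : ℝ)) - Real.log (Real.log N) := by
        have := Real.one_sub_inv_le_log_of_pos (div_pos hl' hl)
        rwa [inv_div, Real.log_div hl'.ne' hl.ne'] at this
      have h3 : (Real.log N + c) * (1 / Real.log N - 1 / Real.log ((N + 1 : ℕ) : ℝ)) =
          (1 - Real.log N / Real.log ((N + 1 : ℕ) : ℝ)) + c / Real.log N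
            - c / Real.log ((N + 1 : ℕ) : ℝ) := by
        field_simp
        ring
      have h4 : A N * (1 / Real.log N - 1 / Real.log ((N + 1 : ℕ) : ℝ)) =
        A N / Real.log N - A N / Real.log ((N + 1 : ℕ) : ℝ) := by ring
      linarith
  refine ⟨|K| + 1, by positivity, fun N hN => ?_⟩
  have hl : 0 < Real.log N := Real.log_pos (by exact_mod_cast hN)
  have h1 := key N hN
  have h2 : A N / Real.log N ≤ 1 + c / Real.log N := by
    rw [div_le_iff₀ hl, add_mul, div_mul_cancel₀ _ hl.ne', one_mul]
    exact sum_primes_log_div_le N (by omega)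
  have := le_abs_self K
  change S N ≤ _
  linarith

end Mertens

section BoxCounting

theorem card_Icc_filter_modEq_le (N : ℕ) (Q : ℕ) (hQ : 0 < Q) (v : ℤ) :
    (((Icc (-(N : ℤ)) N).filter fun x => x ≡ v [ZMOD Q]).card : ℝ) ≤
      (2 * N + 1 : ℝ) / Q + 1 := by
  have hset : Icc (-(N : ℤ)) N = Ico (-(N : ℤ)) (N + 1) := by
    ext x
    simp only [mem_Icc, mem_Ico]
    omega
  have hQ' : (0 : ℚ) < Q := by exact_mod_cast hQ
  have h := Int.Ico_filter_modEq_card (-(N : ℤ)) (N + 1) (r := Q) (by exact_mod_cast hQ) v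
  have hq : (((Icc (-(N : ℤ)) N).filter fun x => x ≡ v [ZMOD Q]).card : ℚ) ≤
      (2 * N + 1 : ℚ) / Q + 1 := by
    rw [hset]
    have h' := congrArg (Int.cast : ℤ → ℚ) h
    push_cast at h'
    convert le_of_eq_of_le h' ?_
    refine max_le ?_ (by positivity)
    have h1 := Int.ceil_lt_add_one (((N : ℚ) + 1 - v) / Q)
    have h2 := Int.le_ceil ((-(N : ℚ) - v) / Q)
    have h3 : (2 * N + 1 : ℚ) / Q = ((N : ℚ) + 1 - v) / Q - (-(N : ℚ) - v) / Q := by ring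
    linarith
  have := (Rat.cast_le (K := ℝ)).mpr hq
  push_cast at this
  exact this

/-- The number of points of the box whose reductions modulo the primes `p ∈ S` lie in prescribed
sets `B p`. -/
theorem card_coeffBox_filter_residues_le (n N : ℕ) (S : Finset ℕ) (hS : ∀ p ∈ S, p.Prime)
    (B : ∀ p : ℕ, Finset (Fin n → ZMod p)) :
    (((coeffBox n N).filter fun a => ∀ p ∈ S, (fun i => (a i : ZMod p)) ∈ B p).card : ℝ) ≤
      ((2 * N + 1 : ℝ) / (∏ p ∈ S, p : ℕ) + 1) ^ n * ∏ p ∈ S, ((B p).card : ℝ) := by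
  set Q := ∏ p ∈ S, p with hQdef
  have hQ : 0 < Q := Finset.prod_pos fun p hp => (hS p hp).pos
  set x : ℝ := (2 * N + 1 : ℝ) / Q + 1 with hx
  have hx0 : 0 ≤ x := by positivity
  have key := Finset.card_le_mul_card_image_of_maps_to
    (s := (coeffBox n N).filter fun a => ∀ p ∈ S, (fun i => (a i : ZMod p)) ∈ B p)
    (t := S.pi B) (f := fun a p _ i => (a i : ZMod p))
    (fun a ha => Finset.mem_pi.mpr fun p hp => (mem_filter.mp ha).2 p hp) (⌊x⌋₊ ^ n) ?_
  · rw [Finset.card_pi] at key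
    calc _ ≤ ((⌊x⌋₊ ^ n * ∏ p ∈ S, (B p).card : ℕ) : ℝ) := by exact_mod_cast key
      _ = (⌊x⌋₊ : ℝ) ^ n * ∏ p ∈ S, ((B p).card : ℝ) := by push_cast; rfl
      _ ≤ _ := by
        exact mul_le_mul_of_nonneg_right
          (pow_le_pow_left₀ (Nat.cast_nonneg _) (Nat.floor_le hx0) n)
          (Finset.prod_nonneg fun _ _ => Nat.cast_nonneg _)
  · intro b _
    rcases Finset.eq_empty_or_nonempty (((coeffBox n N).filter fun a => ∀ p ∈ S,
      (fun i => (a i : ZMod p)) ∈ B p).filter fun a => (fun p _ i => (a i : ZMod p)) = b)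
      with h | ⟨a₀, ha₀⟩
    · rw [h]
      simp
    · have hsub : (((coeffBox n N).filter fun a => ∀ p ∈ S,
          (fun i => (a i : ZMod p)) ∈ B p).filter fun a => (fun p _ i => (a i : ZMod p)) = b) ⊆
          Fintype.piFinset fun i => (Icc (-(N : ℤ)) N).filter fun x => x ≡ a₀ i [ZMOD Q] := by
        intro a ha
        rw [mem_filter, mem_filter] at ha ha₀
        refine Fintype.mem_piFinset.mpr fun i => mem_filter.mpr
          ⟨Fintype.mem_piFinset.mp ha.1.1 i, ?_⟩
        refine (Int.modEq_iff_dvd.mpr ?_)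
        have hcast : ((Q : ℕ) : ℤ) = ∏ p ∈ S, (p : ℤ) := by rw [hQdef]; push_cast; rfl
        rw [hcast]
        refine Finset.prod_dvd_of_coprime (fun p hp q hq hpq => ?_) fun p hp => ?_
        · exact Nat.isCoprime_iff_coprime.mpr
            ((Nat.coprime_primes (hS p hp) (hS q hq)).mpr hpq)
        · have h1 := congrFun (congrFun (congrFun (ha.2.trans ha₀.2.symm) p) hp) i
          exact (ZMod.intCast_eq_intCast_iff_dvd_sub _ _ _).mp h1
      refine (Finset.card_le_card hsub).trans ?_
      rw [Fintype.card_piFinset]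
      refine (Finset.prod_le_pow_card _ _ ⌊x⌋₊ fun i _ => ?_).trans (by simp)
      exact Nat.le_floor (card_Icc_filter_modEq_le N Q hQ (a₀ i))

theorem card_coeffBox (n N : ℕ) : (coeffBox n N).card = (2 * N + 1) ^ n := by
  rw [coeffBox, Fintype.card_piFinset]
  simp
  congr 1
  omega

end BoxCounting

section MonicOfCoeffs

variable {R : Type*} [CommRing R]

/-- The monic polynomial of degree `n` with lower coefficients `a`. -/
def monicOfCoeffs (n : ℕ) (a : Fin n → R) : R[X] :=
  X ^ n + ∑ i : Fin n, C (a i) * X ^ (i : ℕ)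

theorem monicOfCoeffs_monic (n : ℕ) (a : Fin n → R) : (monicOfCoeffs n a).Monic :=
  monic_X_pow_add (degree_sum_fin_lt a)

theorem natDegree_monicOfCoeffs [Nontrivial R] (n : ℕ) (a : Fin n → R) :
    (monicOfCoeffs n a).natDegree = n := by
  refine natDegree_eq_of_degree_eq_some ?_
  rw [monicOfCoeffs, degree_add_eq_left_of_degree_lt, degree_X_pow]
  rw [degree_X_pow]
  exact degree_sum_fin_lt a

theorem coeff_monicOfCoeffs (n : ℕ) (a : Fin n → R) (i : Fin n) :
    (monicOfCoeffs n a).coeff i = a i := by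
  rw [monicOfCoeffs, coeff_add, coeff_X_pow, if_neg i.2.ne, zero_add, finsetSum_coeff,
    Finset.sum_eq_single i]
  · simp
  · intro j _ hj
    rw [coeff_C_mul, coeff_X_pow, if_neg (fun h => hj (Fin.ext h.symm)), mul_zero]
  · simp

theorem monicOfCoeffs_injective (n : ℕ) :
    Function.Injective (monicOfCoeffs (R := R) n) := by
  intro a b h
  funext i
  rw [← coeff_monicOfCoeffs n a, h, coeff_monicOfCoeffs]

theorem monicOfCoeffs_coeff {n : ℕ} {g : R[X]} (hg : g.Monic) (hn : g.natDegree = n) :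
    monicOfCoeffs n (fun i => g.coeff i) = g := by
  conv_rhs => rw [hg.as_sum, hn, ← Fin.sum_univ_eq_sum_range (fun i => C (g.coeff i) * X ^ i)]
  rfl

theorem map_monicOfCoeffs {S : Type*} [CommRing S] (φ : R →+* S) (n : ℕ) (a : Fin n → R) :
    (monicOfCoeffs n a).map φ = monicOfCoeffs n (fun i => φ (a i)) := by
  simp [monicOfCoeffs, Polynomial.map_sum]

theorem intPoly_eq_monicOfCoeffs (n : ℕ) (a : Fin n → ℤ) : intPoly n a = monicOfCoeffs n a := rfl

end MonicOfCoeffs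

section FiniteFieldCounts

variable (p : ℕ) [Fact p.Prime]

theorem exists_monic_sq_dvd_of_not_squarefree {k : Type*} [Field k] {g : k[X]} (hg : g ≠ 0)
    (h : ¬ Squarefree g) : ∃ q : k[X], q.Monic ∧ 1 ≤ q.natDegree ∧ q ^ 2 ∣ g := by
  obtain ⟨x, hx, hu⟩ : ∃ x, x * x ∣ g ∧ ¬ IsUnit x := by
    simpa [Squarefree] using h
  have hx0 : x ≠ 0 := by
    rintro rfl
    simp at hx
    exact hg hx
  have hlc : x.leadingCoeff⁻¹ ≠ 0 := inv_ne_zero (leadingCoeff_ne_zero.mpr hx0)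
  refine ⟨x * C x.leadingCoeff⁻¹, monic_mul_leadingCoeff_inv hx0, ?_, ?_⟩
  · rw [natDegree_mul_C hlc]
    by_contra hcon
    exact hu ((isUnit_iff_degree_eq_zero).mpr
      (by rw [degree_eq_natDegree hx0]; norm_cast; omega))
  · have hu' : IsUnit (C x.leadingCoeff⁻¹ : k[X]) := isUnit_C.mpr hlc.isUnit
    rw [mul_pow, (hu'.pow 2).mul_right_dvd, sq]
    exact hx

/-- Among the `p ^ n` monic polynomials of degree `n`, at most `p ^ (n-1) + n p ^ (n-2)` fail to be
squarefree. -/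
theorem card_not_squarefree_le (n : ℕ) (hn : 2 ≤ n) :
    ((univ : Finset (Fin n → ZMod p)).filter
      fun a => ¬ Squarefree (monicOfCoeffs n a)).card ≤ p ^ (n - 1) + n * p ^ (n - 2) := by
  have hp : p.Prime := Fact.out
  let T : ℕ → Finset (Fin n → ZMod p) := fun d =>
    (univ : Finset ((Fin d → ZMod p) × (Fin (n - 2 * d) → ZMod p))).image fun bc =>
      fun i => (monicOfCoeffs d bc.1 ^ 2 * monicOfCoeffs (n - 2 * d) bc.2).coeff i
  have hsub : ((univ : Finset (Fin n → ZMod p)).filter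
      fun a => ¬ Squarefree (monicOfCoeffs n a)) ⊆ (Icc 1 (n / 2)).biUnion T := by
    intro a ha
    have hmon := monicOfCoeffs_monic n a
    obtain ⟨q, hq, hd, hdvd⟩ := exists_monic_sq_dvd_of_not_squarefree hmon.ne_zero
      (mem_filter.mp ha).2
    obtain ⟨r, hr⟩ := hdvd
    have hrm : r.Monic := (hq.pow 2).of_mul_monic_left (hr ▸ hmon)
    have hdeg : n = 2 * q.natDegree + r.natDegree := by
      rw [← (hq.natDegree_pow 2), ← (hq.pow 2).natDegree_mul hrm, ← hr, natDegree_monicOfCoeffs]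
    refine mem_biUnion.mpr ⟨q.natDegree, mem_Icc.mpr ⟨hd, by omega⟩, mem_image.mpr
      ⟨(fun i => q.coeff i, fun i => r.coeff i), mem_univ _, ?_⟩⟩
    funext i
    rw [monicOfCoeffs_coeff hq rfl, monicOfCoeffs_coeff hrm (by omega), ← hr, coeff_monicOfCoeffs]
  have hT : ∀ d ∈ Icc 1 (n / 2), (T d).card ≤ p ^ (n - d) := by
    intro d hd
    rw [mem_Icc] at hd
    refine Finset.card_image_le.trans (le_of_eq ?_)
    rw [card_univ, Fintype.card_prod]
    simp only [Fintype.card_fun, ZMod.card, Fintype.card_fin]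
    rw [← pow_add]
    congr 1
    omega
  calc _ ≤ ∑ d ∈ Icc 1 (n / 2), (T d).card :=
        (Finset.card_le_card hsub).trans Finset.card_biUnion_le
    _ ≤ ∑ d ∈ Icc 1 (n / 2), p ^ (n - d) := Finset.sum_le_sum hT
    _ = p ^ (n - 1) + ∑ d ∈ Icc 2 (n / 2), p ^ (n - d) := by
        rw [← Finset.add_sum_Ioc_eq_sum_Icc (by omega : 1 ≤ n / 2)]
        rfl
    _ ≤ p ^ (n - 1) + ∑ d ∈ Icc 2 (n / 2), p ^ (n - 2) := by
        gcongr with d hd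
        · exact hp.one_le
        · exact (mem_Icc.mp hd).1
    _ ≤ p ^ (n - 1) + n * p ^ (n - 2) := by
        rw [Finset.sum_const, smul_eq_mul, Nat.card_Icc]
        gcongr
        omega

theorem pow_le_mul_card_irreducible_of_finrank (F : Type*) [Field F] [Fintype F]
    [Algebra (ZMod p) F] (d : ℕ) (hd : 1 ≤ d) (hdp : 2 * d ≤ p)
    (hfr : Module.finrank (ZMod p) F = d) :
    p ^ d ≤ 2 * d * ((univ : Finset (Fin d → ZMod p)).filter
      fun b => Irreducible (monicOfCoeffs d b)).card := by
  have hp : p.Prime := Fact.out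
  have hcard : Fintype.card F = p ^ d := by
    rw [Module.card_eq_pow_finrank (K := ZMod p), ZMod.card, hfr]
  have hint : ∀ x : F, IsIntegral (ZMod p) x := fun x => Algebra.IsIntegral.isIntegral x
  set good := (univ : Finset F).filter fun x => (minpoly (ZMod p) x).natDegree = d with hgood
  set bad := (univ : Finset F).filter fun x => ¬ (minpoly (ZMod p) x).natDegree = d with hbad
  have hsplit : good.card + bad.card = p ^ d := by
    rw [hgood, hbad, Finset.card_filter_add_card_filter_not, card_univ, hcard]
  have hgoodle : good.card ≤ d * ((univ : Finset (Fin d → ZMod p)).filter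
      fun b => Irreducible (monicOfCoeffs d b)).card := by
    refine Finset.card_le_mul_card_image_of_maps_to
      (f := fun x => fun i : Fin d => (minpoly (ZMod p) x).coeff i) (fun x hx => ?_) d ?_
    · refine mem_filter.mpr ⟨mem_univ _, ?_⟩
      rw [monicOfCoeffs_coeff (minpoly.monic (hint x)) (mem_filter.mp hx).2]
      exact minpoly.irreducible (hint x)
    · intro b _
      have : (good.filter fun x => (fun i : Fin d => (minpoly (ZMod p) x).coeff i) = b) ⊆
          (((monicOfCoeffs d b).map (algebraMap (ZMod p) F)).roots).toFinset := by
        intro x hx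
        rw [mem_filter] at hx
        have h1 : monicOfCoeffs d b = minpoly (ZMod p) x := by
          rw [← hx.2]
          exact monicOfCoeffs_coeff (minpoly.monic (hint x)) (mem_filter.mp hx.1).2
        rw [Multiset.mem_toFinset, mem_roots ((monicOfCoeffs_monic d b).map _).ne_zero,
          IsRoot, eval_map_algebraMap, h1, minpoly.aeval]
      refine (Finset.card_le_card this).trans ((Multiset.toFinset_card_le _).trans
        ((card_roots' _).trans ?_))
      rw [(monicOfCoeffs_monic d b).natDegree_map, natDegree_monicOfCoeffs]
  have hbadle : bad.card ≤ (d - 1) * p ^ (d - 1) := by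
    have hsub : bad ⊆ (Ico 1 d).biUnion fun e => ((X ^ p ^ e - X : F[X]).roots).toFinset := by
      intro x hx
      have hne := (mem_filter.mp hx).2
      have hle : (minpoly (ZMod p) x).natDegree ≤ d := (minpoly.natDegree_le x).trans_eq hfr
      have hpos := minpoly.natDegree_pos (hint x)
      refine mem_biUnion.mpr ⟨(minpoly (ZMod p) x).natDegree, mem_Ico.mpr ⟨hpos, by omega⟩, ?_⟩
      have hdvd := (minpoly.irreducible (hint x)).natDegree_dvd_iff_dvd_X_pow_card_pow_sub_X.mp
        (dvd_refl _)
      rw [Nat.card_zmod] at hdvd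
      have h0 := aeval_eq_zero_of_dvd_aeval_eq_zero hdvd (minpoly.aeval (ZMod p) x)
      rw [Multiset.mem_toFinset, mem_roots
        (FiniteField.X_pow_card_pow_sub_X_ne_zero F hpos.ne' hp.one_lt)]
      simpa using h0
    calc bad.card ≤ ∑ e ∈ Ico 1 d, (((X ^ p ^ e - X : F[X]).roots).toFinset).card :=
          (Finset.card_le_card hsub).trans Finset.card_biUnion_le
      _ ≤ ∑ e ∈ Ico 1 d, p ^ (d - 1) := by
          refine Finset.sum_le_sum fun e he => ?_
          rw [mem_Ico] at he
          refine (Multiset.toFinset_card_le _).trans ((card_roots' _).trans ?_)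
          rw [FiniteField.X_pow_card_pow_sub_X_natDegree_eq F (by omega) hp.one_lt]
          exact Nat.pow_le_pow_right hp.pos (by omega)
      _ = (d - 1) * p ^ (d - 1) := by simp
  have h2 : 2 * ((d - 1) * p ^ (d - 1)) ≤ p ^ d := by
    calc 2 * ((d - 1) * p ^ (d - 1)) = (2 * (d - 1)) * p ^ (d - 1) := by ring
      _ ≤ p * p ^ (d - 1) := by gcongr; omega
      _ = p ^ d := by rw [← pow_succ']; congr 1; omega
  nlinarith

/-- A positive proportion of the monic polynomials of degree `d` are irreducible. -/
theorem pow_le_mul_card_irreducible (d : ℕ) (hd : 1 ≤ d) (hdp : 2 * d ≤ p) :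
    p ^ d ≤ 2 * d * ((univ : Finset (Fin d → ZMod p)).filter
      fun b => Irreducible (monicOfCoeffs d b)).card :=
  have : Fintype (GaloisField p d) := Fintype.ofFinite _
  pow_le_mul_card_irreducible_of_finrank p (GaloisField p d) d hd hdp
    (GaloisField.finrank p (by omega))

end FiniteFieldCounts

section FactorizationTypes

/-- `g` is a linear factor times an irreducible polynomial of degree different from one. -/
def IsLinearMulIrreducible {k : Type*} [Field k] (g : k[X]) : Prop :=
  ∃ (c : k) (h : k[X]), h.Monic ∧ Irreducible h ∧ h.natDegree ≠ 1 ∧ g = (X - C c) * h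

/-- `g` is an irreducible quadratic times a product of distinct linear factors. -/
def IsQuadraticMulLinears {k : Type*} [Field k] (g : k[X]) : Prop :=
  ∃ (s : Finset k) (q : k[X]), q.Monic ∧ Irreducible q ∧ q.natDegree = 2 ∧
    g = q * ∏ c ∈ s, (X - C c)

variable (p : ℕ) [Fact p.Prime]

theorem pow_le_mul_card_linearMulIrreducible (n : ℕ) (hn : 3 ≤ n) (hnp : 2 * n ≤ p) :
    p ^ n ≤ 2 * n * ((univ : Finset (Fin n → ZMod p)).filter
      fun a => IsLinearMulIrreducible (monicOfCoeffs n a)).card := by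
  have hI := pow_le_mul_card_irreducible p (n - 1) (by omega) (by omega)
  set I := (univ : Finset (Fin (n - 1) → ZMod p)).filter
    fun b => Irreducible (monicOfCoeffs (n - 1) b) with hIdef
  have hmonic : ∀ x : ZMod p × (Fin (n - 1) → ZMod p),
      ((X - C x.1) * monicOfCoeffs (n - 1) x.2).Monic := fun x =>
    (monic_X_sub_C _).mul (monicOfCoeffs_monic _ _)
  have hdeg : ∀ x : ZMod p × (Fin (n - 1) → ZMod p),
      ((X - C x.1) * monicOfCoeffs (n - 1) x.2).natDegree = n := by
    intro x
    rw [(monic_X_sub_C _).natDegree_mul (monicOfCoeffs_monic _ _), natDegree_X_sub_C,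
      natDegree_monicOfCoeffs]
    omega
  have hle : ((univ : Finset (ZMod p)) ×ˢ I).card ≤ ((univ : Finset (Fin n → ZMod p)).filter
      fun a => IsLinearMulIrreducible (monicOfCoeffs n a)).card := by
    refine Finset.card_le_card_of_injOn
      (fun x => fun i : Fin n => ((X - C x.1) * monicOfCoeffs (n - 1) x.2).coeff i) ?_ ?_
    · intro x hx
      have hx2 := (mem_filter.mp (mem_product.mp hx).2).2
      refine mem_filter.mpr ⟨mem_univ _, x.1, monicOfCoeffs (n - 1) x.2,
        monicOfCoeffs_monic _ _, hx2, ?_, monicOfCoeffs_coeff (hmonic x) (hdeg x)⟩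
      rw [natDegree_monicOfCoeffs]
      omega
    · intro x hx y hy hxy
      have hx2 := (mem_filter.mp (mem_product.mp hx).2).2
      have heq : (X - C x.1) * monicOfCoeffs (n - 1) x.2 =
          (X - C y.1) * monicOfCoeffs (n - 1) y.2 := by
        rw [← monicOfCoeffs_coeff (hmonic x) (hdeg x), ← monicOfCoeffs_coeff (hmonic y) (hdeg y)]
        exact congrArg _ hxy
      have h1 : x.1 = y.1 := by
        have he := congrArg (eval y.1) heq
        simp only [eval_mul, eval_sub, eval_X, eval_C, sub_self, zero_mul] at he
        rcases mul_eq_zero.mp he with h | h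
        · exact (sub_eq_zero.mp h).symm
        · exact absurd h (hx2.not_isRoot_of_natDegree_ne_one
            (by rw [natDegree_monicOfCoeffs]; omega))
      rw [h1] at heq
      exact Prod.ext h1 (monicOfCoeffs_injective _ (mul_left_cancel₀ (X_sub_C_ne_zero _) heq))
  rw [card_product, card_univ, ZMod.card] at hle
  calc p ^ n = p * p ^ (n - 1) := by rw [← pow_succ']; congr 1; omega
    _ ≤ p * (2 * (n - 1) * I.card) := by gcongr
    _ = 2 * (n - 1) * (p * I.card) := by ring
    _ ≤ 2 * n * _ := by
      gcongr
      omega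

theorem pow_le_mul_card_quadraticMulLinears (n : ℕ) (hn : 2 ≤ n) (hnp : 2 * n ≤ p) :
    p ^ n ≤ 2 ^ n * n.factorial * ((univ : Finset (Fin n → ZMod p)).filter
      fun a => IsQuadraticMulLinears (monicOfCoeffs n a)).card := by
  have hI := pow_le_mul_card_irreducible p 2 (by omega) (by omega)
  set I := (univ : Finset (Fin 2 → ZMod p)).filter
    fun b => Irreducible (monicOfCoeffs 2 b) with hIdef
  set P := (univ : Finset (ZMod p)).powersetCard (n - 2) with hP
  let Φ : Finset (ZMod p) × (Fin 2 → ZMod p) → (ZMod p)[X] := fun x =>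
    monicOfCoeffs 2 x.2 * ∏ c ∈ x.1, (X - C c)
  have hmonic : ∀ x, (Φ x).Monic := fun x =>
    (monicOfCoeffs_monic _ _).mul (monic_prod_of_monic _ _ fun c _ => monic_X_sub_C c)
  have hdeg : ∀ x ∈ P ×ˢ I, (Φ x).natDegree = n := by
    intro x hx
    have hc := (mem_powersetCard.mp (mem_product.mp hx).1).2
    rw [(monicOfCoeffs_monic _ _).natDegree_mul
      (monic_prod_of_monic _ _ fun c _ => monic_X_sub_C c), natDegree_monicOfCoeffs,
      natDegree_prod_of_monic _ _ fun c _ => monic_X_sub_C c]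
    simp
    omega
  have hroot : ∀ x ∈ P ×ˢ I, ∀ c, c ∈ x.1 ↔ (Φ x).eval c = 0 := by
    intro x hx c
    have hx2 := (mem_filter.mp (mem_product.mp hx).2).2
    have hq : eval c (monicOfCoeffs 2 x.2) ≠ 0 :=
      hx2.not_isRoot_of_natDegree_ne_one (by rw [natDegree_monicOfCoeffs]; omega)
    rw [eval_mul, mul_eq_zero, or_iff_right hq, eval_prod, Finset.prod_eq_zero_iff]
    constructor
    · exact fun h => ⟨c, h, by simp⟩
    · rintro ⟨d, hd, h⟩
      rw [eval_sub, eval_X, eval_C, sub_eq_zero] at h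
      exact h ▸ hd
  have hle : (P ×ˢ I).card ≤ ((univ : Finset (Fin n → ZMod p)).filter
      fun a => IsQuadraticMulLinears (monicOfCoeffs n a)).card := by
    refine Finset.card_le_card_of_injOn (fun x => fun i : Fin n => (Φ x).coeff i) ?_ ?_
    · intro x hx
      exact mem_filter.mpr ⟨mem_univ _, x.1, monicOfCoeffs 2 x.2, monicOfCoeffs_monic _ _,
        (mem_filter.mp (mem_product.mp hx).2).2, natDegree_monicOfCoeffs _ _,
        monicOfCoeffs_coeff (hmonic x) (hdeg x hx)⟩
    · intro x hx y hy hxy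
      have heq : Φ x = Φ y := by
        rw [← monicOfCoeffs_coeff (hmonic x) (hdeg x hx),
          ← monicOfCoeffs_coeff (hmonic y) (hdeg y hy)]
        exact congrArg _ hxy
      have h1 : x.1 = y.1 := by
        ext c
        rw [hroot x hx, hroot y hy, heq]
      refine Prod.ext h1 (monicOfCoeffs_injective _ ?_)
      have heq' : monicOfCoeffs 2 x.2 * ∏ c ∈ x.1, (X - C c) =
        monicOfCoeffs 2 y.2 * ∏ c ∈ y.1, (X - C c) := heq
      rw [h1] at heq'
      exact mul_right_cancel₀
        (monic_prod_of_monic _ _ fun c _ => monic_X_sub_C c).ne_zero heq'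
  rw [card_product, card_powersetCard, card_univ, ZMod.card] at hle
  have hchoose : p ^ (n - 2) ≤ 2 ^ (n - 2) * ((n - 2).factorial * p.choose (n - 2)) := by
    rw [← Nat.descFactorial_eq_factorial_mul_choose]
    calc p ^ (n - 2) ≤ (2 * (p + 1 - (n - 2))) ^ (n - 2) := Nat.pow_le_pow_left (by omega) _
      _ = 2 ^ (n - 2) * (p + 1 - (n - 2)) ^ (n - 2) := mul_pow _ _ _
      _ ≤ _ := by
        gcongr
        exact Nat.pow_sub_le_descFactorial p (n - 2)
  calc p ^ n = p ^ (n - 2) * p ^ 2 := by rw [← pow_add]; congr 1; omega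
    _ ≤ 2 ^ (n - 2) * ((n - 2).factorial * p.choose (n - 2)) * (2 * 2 * I.card) :=
      Nat.mul_le_mul hchoose hI
    _ = 2 ^ (n - 2 + 2) * (n - 2).factorial * (p.choose (n - 2) * I.card) := by ring
    _ ≤ 2 ^ n * n.factorial * _ := by
      gcongr
      · norm_num
      · omega
      · omega

end FactorizationTypes

section Frobenius

variable {p : ℕ} [hp : Fact p.Prime]

open NumberField in
/-- If `f` is separable modulo `p`, the reduction of its roots modulo a prime above `p` is
injective, and some Galois automorphism acts on the reduced roots as the Frobenius. -/
theorem exists_frobenius {f : ℤ[X]} (hf : f.Monic)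
    (hsep : (f.map (Int.castRingHom (ZMod p))).Separable)
    (K : Type) [Field K] [NumberField K] [IsGalois ℚ K]
    (hsplit : ((f.map (Int.castRingHom ℚ)).map (algebraMap ℚ K)).Splits) :
    ∃ (k : Type) (_ : Field k) (_ : Finite k) (_ : Algebra (ZMod p) k) (σ : K ≃ₐ[ℚ] K)
      (ρ : (f.map (Int.castRingHom ℚ)).rootSet K → k),
      Function.Injective ρ ∧ (∀ x, ρ (σ • x) = ρ x ^ p) ∧
      (f.map (Int.castRingHom (ZMod p))).map (algebraMap (ZMod p) k) =
        ∏ x, (X - C (ρ x)) := by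
  set g := f.map (Int.castRingHom ℚ) with hg
  have hgm : g.Monic := hf.map _
  have hpI : (Ideal.span {(p : ℤ)}).IsPrime := by
    rw [Ideal.span_singleton_prime (by exact_mod_cast hp.out.ne_zero)]
    exact Nat.prime_iff_prime_int.mp hp.out
  obtain ⟨Q, -, hQp, hQ⟩ := Ideal.exists_ideal_over_prime_of_isIntegral (S := 𝓞 K)
    (Ideal.span {(p : ℤ)}) ⊥ (by
      rw [← RingHom.ker_eq_comap_bot, (RingHom.injective_iff_ker_eq_bot _).mp
        (FaithfulSMul.algebraMap_injective ℤ (𝓞 K))]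
      exact bot_le)
  have hQ0 : Q ≠ ⊥ := by
    rintro rfl
    rw [← RingHom.ker_eq_comap_bot, (RingHom.injective_iff_ker_eq_bot _).mp
        (FaithfulSMul.algebraMap_injective ℤ (𝓞 K)), eq_comm, Ideal.span_singleton_eq_bot] at hQ
    exact hp.out.ne_zero (by exact_mod_cast hQ)
  have : Finite (𝓞 K ⧸ Q) := Ideal.finiteQuotientOfFreeOfNeBot Q hQ0
  have : Q.IsMaximal := hQp.isMaximal hQ0
  let : Field (𝓞 K ⧸ Q) := Ideal.Quotient.field Q
  obtain ⟨σ, hσ⟩ := IsArithFrobAt.exists_of_isInvariant ℤ (K ≃ₐ[ℚ] K) Q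
  have hcard : Nat.card (ℤ ⧸ Q.under ℤ) = p := by
    rw [Ideal.under_def, hQ, Nat.card_congr (Int.quotientSpanNatEquivZMod p).toEquiv,
      Nat.card_zmod]
  have : CharP (𝓞 K ⧸ Q) p := by
    refine (CharP.charP_iff_prime_eq_zero hp.out).mpr ?_
    have : (p : ℤ) ∈ Q.comap (algebraMap ℤ (𝓞 K)) := hQ ▸ Ideal.mem_span_singleton_self _
    rw [Ideal.mem_comap] at this
    have := Ideal.Quotient.eq_zero_iff_mem.mpr this
    simpa using this
  let : Algebra (ZMod p) (𝓞 K ⧸ Q) := ZMod.algebra _ p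
  -- the roots, as a multiset of algebraic integers
  have hint : ∀ x ∈ (g.map (algebraMap ℚ K)).roots, IsIntegral ℤ x := by
    intro x hx
    refine ⟨f, hf, ?_⟩
    have := (mem_roots'.mp hx).2
    rw [IsRoot.def, hg, Polynomial.map_map, eval_map] at this
    rwa [show algebraMap ℤ K = (algebraMap ℚ K).comp (Int.castRingHom ℚ) from
      Subsingleton.elim _ _]
  have hmem : ∀ x, x ∈ g.rootSet K ↔ x ∈ (g.map (algebraMap ℚ K)).roots := fun x => by
    rw [rootSet_def, Finset.mem_coe, Multiset.mem_toFinset, aroots_def]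
  obtain ⟨t, htK⟩ : ∃ t : Multiset (𝓞 K),
      t.map (algebraMap (𝓞 K) K) = (g.map (algebraMap ℚ K)).roots :=
    ⟨(g.map (algebraMap ℚ K)).roots.attach.map (fun x => (⟨x.1, hint x.1 x.2⟩ : 𝓞 K)),
      (Multiset.map_map _ _ _).trans (Multiset.attach_map_val _)⟩
  have hft : f.map (algebraMap ℤ (𝓞 K)) = (t.map (fun x => X - C x)).prod := by
    apply Polynomial.map_injective (algebraMap (𝓞 K) K) RingOfIntegers.coe_injective
    have h1 := hsplit.eq_prod_roots_of_monic (hgm.map _)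
    rw [← htK] at h1
    rw [Polynomial.map_map, Polynomial.map_multiset_prod, Multiset.map_map]
    rw [hg, Polynomial.map_map, Multiset.map_map] at h1
    rw [show (algebraMap (𝓞 K) K).comp (algebraMap ℤ (𝓞 K)) =
      (algebraMap ℚ K).comp (Int.castRingHom ℚ) from Subsingleton.elim _ _, h1]
    congr 1
    refine Multiset.map_congr rfl fun x _ => ?_
    simp
  have hfk : (f.map (Int.castRingHom (ZMod p))).map (algebraMap (ZMod p) (𝓞 K ⧸ Q)) =
      ((t.map (Ideal.Quotient.mk Q)).map (fun x => X - C x)).prod := by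
    have := congrArg (Polynomial.map (Ideal.Quotient.mk Q)) hft
    rw [Polynomial.map_map, Polynomial.map_multiset_prod, Multiset.map_map] at this
    rw [Polynomial.map_map, Multiset.map_map]
    rw [show (algebraMap (ZMod p) (𝓞 K ⧸ Q)).comp (Int.castRingHom (ZMod p)) =
      (Ideal.Quotient.mk Q).comp (algebraMap ℤ (𝓞 K)) from Subsingleton.elim _ _, this]
    congr 1
    refine Multiset.map_congr rfl fun x _ => ?_
    simp
  have hnd : (t.map (Ideal.Quotient.mk Q)).Nodup := by
    have h1 := nodup_roots (hsep.map (f := algebraMap (ZMod p) (𝓞 K ⧸ Q)))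
    rwa [hfk, roots_multiset_prod_X_sub_C] at h1
  have htnd : t.Nodup := hnd.of_map _
  have hrnd : (g.map (algebraMap ℚ K)).roots.Nodup := by
    rw [← htK]
    exact htnd.map RingOfIntegers.coe_injective
  let l : g.rootSet K → 𝓞 K := fun x => ⟨x.1, hint _ ((hmem x).mp x.2)⟩
  have hlinj : Function.Injective l := fun x y h => Subtype.ext (congrArg (fun z : 𝓞 K => (z : K)) h)
  have hlt : t = (Finset.univ : Finset (g.rootSet K)).val.map l := by
    refine (Multiset.Nodup.ext htnd (Finset.univ.nodup.map hlinj)).mpr fun y => ?_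
    have h1 : y ∈ t ↔ (y : K) ∈ (g.map (algebraMap ℚ K)).roots := by
      rw [← htK, Multiset.mem_map]
      exact ⟨fun h => ⟨y, h, rfl⟩, fun ⟨z, hz, h⟩ => RingOfIntegers.coe_injective h ▸ hz⟩
    rw [h1, Multiset.mem_map]
    constructor
    · intro h
      exact ⟨⟨y, (hmem _).mpr h⟩, Finset.mem_univ _, RingOfIntegers.ext rfl⟩
    · rintro ⟨x, -, rfl⟩
      exact (hmem x).mp x.2
  refine ⟨𝓞 K ⧸ Q, inferInstance, inferInstance, inferInstance, σ,
    fun x => Ideal.Quotient.mk Q (l x), ?_, ?_, ?_⟩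
  · rw [hlt, Multiset.map_map] at hnd
    intro x y hxy
    exact Multiset.inj_on_of_nodup_map hnd x (Finset.mem_univ _) y (Finset.mem_univ _) hxy
  · intro x
    have h1 := hσ.mk_apply (l x)
    rw [hcard] at h1
    rw [← h1]
    congr 1
  · rw [hfk, hlt, Multiset.map_map, Multiset.map_map]
    rfl

end Frobenius

section SymmetricGroup

/-- A transitive group containing a transposition, some point stabiliser of which is transitive
on the remaining points, is the full symmetric group. -/
theorem toPermHom_surjective_of_swap {G Ω : Type*} [Group G] [MulAction G Ω] [Finite Ω]
    (h1 : ∀ x y : Ω, ∃ g : G, g • x = y)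
    (h2 : ∃ z : Ω, ∀ x y, x ≠ z → y ≠ z → ∃ g : G, g • z = z ∧ g • x = y)
    (h3 : ∃ (g : G) (a b : Ω), a ≠ b ∧ ∀ x, g • x = Equiv.swap a b x) :
    Function.Surjective (MulAction.toPermHom G Ω) := by
  rw [← MonoidHom.range_eq_top]
  set H := (MulAction.toPermHom G Ω).range with hH
  have hmem : ∀ g : G, MulAction.toPerm g ∈ H := fun g => ⟨g, rfl⟩
  obtain ⟨z, hz⟩ := h2
  obtain ⟨s, a, b, hab, hs⟩ := h3
  have hsab : Equiv.swap a b ∈ H := by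
    convert hmem s
    ext x
    exact (hs x).symm
  have hconj : ∀ (g : G) (x y : Ω), Equiv.swap x y ∈ H → Equiv.swap (g • x) (g • y) ∈ H := by
    intro g x y hxy
    have := H.mul_mem (H.mul_mem (hmem g) hxy) (H.inv_mem (hmem g))
    rwa [← Equiv.swap_apply_apply] at this
  obtain ⟨g, hg⟩ := h1 a z
  have hb : g • b ≠ z := by
    rw [← hg]
    exact fun h => hab (smul_left_cancel g h).symm
  have hzc : ∀ c, Equiv.swap z c ∈ H := by
    intro c
    rcases eq_or_ne c z with rfl | hc
    · rw [Equiv.swap_self]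
      exact H.one_mem
    · obtain ⟨k, hk, hkc⟩ := hz (g • b) c hb hc
      have := hconj k _ _ (hconj g a b hsab)
      rwa [hg, hk, hkc] at this
  rw [eq_top_iff, ← Equiv.Perm.closure_isSwap, Subgroup.closure_le]
  rintro _ ⟨x, y, hxy, rfl⟩
  rcases eq_or_ne x z with rfl | hx
  · exact hzc y
  rcases eq_or_ne y z with rfl | hy
  · rw [Equiv.swap_comm]
    exact hzc x
  have := H.mul_mem (H.mul_mem (hzc x) (hzc y)) (H.inv_mem (hzc x))
  rw [← Equiv.swap_apply_apply, Equiv.swap_apply_left,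
    Equiv.swap_apply_of_ne_of_ne hy hxy.symm] at this
  exact this

end SymmetricGroup

section FrobeniusOrbits

theorem map_pow_smul_eq {p : ℕ} {k G Ω : Type*} [Monoid k] [Monoid G] [MulAction G Ω] {σ : G}
    {ρ : Ω → k} (hσ : ∀ x, ρ (σ • x) = ρ x ^ p) (x : Ω) (i : ℕ) :
    ρ (σ ^ i • x) = ρ x ^ p ^ i := by
  induction i with
  | zero => simp
  | succ i ih => rw [pow_succ', mul_smul, hσ, ih, ← pow_mul, ← pow_succ]

variable {p : ℕ} [hp : Fact p.Prime] {k : Type*} [Field k] [Algebra (ZMod p) k]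

theorem exists_eq_pow_of_irreducible [Finite k] {h : (ZMod p)[X]} (hh : Irreducible h) {α β : k}
    (hα : aeval α h = 0) (hβ : aeval β h = 0) : ∃ i : ℕ, β = α ^ p ^ i := by
  have hint : IsIntegral (ZMod p) α := Algebra.IsIntegral.isIntegral α
  have hmin : minpoly (ZMod p) α ∣ h := minpoly.dvd _ _ hα
  have hassoc := (minpoly.irreducible hint).associated_of_dvd hh hmin
  have hβ' : aeval β (minpoly (ZMod p) α) = 0 := by
    obtain ⟨u, hu⟩ := hassoc.symm
    rw [← hu, map_mul, hβ, zero_mul]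
  obtain ⟨τ, hτ⟩ := minpoly.exists_algEquiv_of_root' (K := ZMod p) (L := k)
    (Algebra.IsAlgebraic.isAlgebraic α) hβ'
  obtain ⟨i, hi⟩ := (FiniteField.bijective_frobeniusAlgEquivOfAlgebraic_pow (ZMod p) k).2 τ
  refine ⟨i, ?_⟩
  rw [← hτ, ← hi]
  simp [FiniteField.coe_frobeniusAlgEquivOfAlgebraic, ZMod.card, AlgEquiv.coe_pow]

theorem exists_algebraMap_eq_of_pow_eq {α : k} (hα : α ^ p = α) :
    ∃ c : ZMod p, algebraMap (ZMod p) k c = α := by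
  have : CharP k p := charP_of_injective_algebraMap (algebraMap (ZMod p) k).injective p
  obtain ⟨m, hm⟩ := (mem_bot_iff_intCast p k).mp ((Subfield.mem_bot_iff_pow_eq_self k p).mpr hα)
  exact ⟨m, by rw [map_intCast, hm]⟩

variable {G Ω : Type*} [Group G] [MulAction G Ω] {σ : G} {ρ : Ω → k}
  {F : (ZMod p)[X]}

theorem aeval_eq_zero_iff_mem_range [Fintype Ω]
    (hF : F.map (algebraMap (ZMod p) k) = ∏ x, (X - C (ρ x))) (α : k) :
    aeval α F = 0 ↔ ∃ x, ρ x = α := by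
  rw [aeval_def, ← eval_map, hF, eval_prod, Finset.prod_eq_zero_iff]
  simp only [eval_sub, eval_X, eval_C, Finset.mem_univ, true_and, sub_eq_zero, eq_comm]

theorem exists_smul_eq_of_irreducible [Finite k] (hρ : Function.Injective ρ)
    (hσ : ∀ x, ρ (σ • x) = ρ x ^ p)
    {h : (ZMod p)[X]} (hh : Irreducible h) {x y : Ω} (hx : aeval (ρ x) h = 0)
    (hy : aeval (ρ y) h = 0) : ∃ i : ℕ, σ ^ i • x = y := by
  obtain ⟨i, hi⟩ := exists_eq_pow_of_irreducible hh hx hy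
  exact ⟨i, hρ (by rw [map_pow_smul_eq hσ, hi])⟩

theorem exists_stabilizer_transitive [Finite k] [Fintype Ω] (hρ : Function.Injective ρ)
    (hσ : ∀ x, ρ (σ • x) = ρ x ^ p)
    (hF : F.map (algebraMap (ZMod p) k) = ∏ x, (X - C (ρ x))) (hT : IsLinearMulIrreducible F) :
    ∃ z : Ω, ∀ x y, x ≠ z → y ≠ z → ∃ g : G, g • z = z ∧ g • x = y := by
  obtain ⟨c, h, -, hh, -, rfl⟩ := hT
  obtain ⟨z, hz⟩ := (aeval_eq_zero_iff_mem_range hF (algebraMap (ZMod p) k c)).mp (by simp)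
  have hroot : ∀ x, x ≠ z → aeval (ρ x) h = 0 := by
    intro x hx
    have := (aeval_eq_zero_iff_mem_range hF (ρ x)).mpr ⟨x, rfl⟩
    rw [map_mul, mul_eq_zero] at this
    refine this.resolve_left fun h0 => hx (hρ ?_)
    rw [hz]
    simpa [sub_eq_zero] using h0
  refine ⟨z, fun x y hx hy => ?_⟩
  obtain ⟨i, hi⟩ := exists_smul_eq_of_irreducible hρ hσ hh (hroot x hx) (hroot y hy)
  refine ⟨σ ^ i, hρ ?_, hi⟩
  rw [map_pow_smul_eq hσ, hz, ← map_pow, ZMod.pow_card_pow]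

theorem exists_smul_eq_swap [Fintype Ω] (hρ : Function.Injective ρ)
    (hσ : ∀ x, ρ (σ • x) = ρ x ^ p)
    (hF : F.map (algebraMap (ZMod p) k) = ∏ x, (X - C (ρ x))) (hT : IsQuadraticMulLinears F) :
    ∃ (a b : Ω), a ≠ b ∧ ∀ x, σ • x = Equiv.swap a b x := by
  obtain ⟨s, q, hqm, hq, hq2, rfl⟩ := hT
  have hqdvd : q.map (algebraMap (ZMod p) k) ∣ ∏ x, (X - C (ρ x)) := by
    rw [← hF, Polynomial.map_mul]
    exact dvd_mul_right _ _
  have hqs : (q.map (algebraMap (ZMod p) k)).Splits :=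
    Splits.of_dvd (Splits.prod fun x _ => Splits.X_sub_C _)
      (Finset.prod_ne_zero_iff.mpr fun x _ => X_sub_C_ne_zero _) hqdvd
  have hqd : (q.map (algebraMap (ZMod p) k)).natDegree = 2 := by
    rw [hqm.natDegree_map, hq2]
  obtain ⟨α, hα⟩ := hqs.exists_eval_eq_zero (by
    rw [degree_eq_natDegree (hqm.map _).ne_zero, hqd]
    decide)
  rw [eval_map, ← aeval_def] at hα
  obtain ⟨a, rfl⟩ := (aeval_eq_zero_iff_mem_range hF α).mp (by rw [map_mul, hα, zero_mul])
  have hqσ : ∀ x, aeval (ρ x) q = 0 → aeval (ρ (σ • x)) q = 0 := by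
    intro x hx
    rw [hσ, ← expand_aeval, ZMod.expand_card, map_pow, hx, zero_pow hp.out.ne_zero]
  have hlin : ∀ x, aeval (ρ x) q ≠ 0 → σ • x = x := by
    intro x hx
    have := (aeval_eq_zero_iff_mem_range hF (ρ x)).mpr ⟨x, rfl⟩
    rw [map_mul, mul_eq_zero, map_prod, Finset.prod_eq_zero_iff] at this
    obtain ⟨c, -, hc⟩ := this.resolve_left hx
    have hc' : ρ x = algebraMap (ZMod p) k c := by simpa [sub_eq_zero] using hc
    refine hρ ?_
    rw [hσ, hc', ← map_pow, ZMod.pow_card]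
  have hab : a ≠ σ • a := by
    intro h
    obtain ⟨c, hc⟩ := exists_algebraMap_eq_of_pow_eq (k := k) (α := ρ a) (by rw [← hσ, ← h])
    rw [← hc, aeval_algebraMap_apply, map_eq_zero, coe_aeval_eq_eval] at hα
    have h1 := degree_eq_one_of_irreducible_of_root hq hα
    rw [degree_eq_natDegree hq.ne_zero, hq2] at h1
    exact absurd h1 (by decide)
  have htwo : ∀ x, aeval (ρ x) q = 0 → x = a ∨ x = σ • a := by
    intro x hx
    by_contra! hne
    have hsub : ({ρ x, ρ a, ρ (σ • a)} : Finset k) ⊆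
        (q.map (algebraMap (ZMod p) k)).roots.toFinset := by
      intro y hy
      rw [Multiset.mem_toFinset, mem_roots (hqm.map _).ne_zero, IsRoot.def, eval_map,
        ← aeval_def]
      simp only [Finset.mem_insert, Finset.mem_singleton] at hy
      rcases hy with rfl | rfl | rfl
      · exact hx
      · exact hα
      · exact hqσ a hα
    have h3 := (Finset.card_le_card hsub).trans
      ((Multiset.toFinset_card_le _).trans (card_roots' _))
    rw [hqd, Finset.card_eq_three.mpr ⟨ρ x, ρ a, ρ (σ • a), hρ.ne hne.1, hρ.ne hne.2,
      hρ.ne hab, rfl⟩] at h3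
    omega
  have hba : σ • σ • a = a :=
    (htwo _ (hqσ _ (hqσ _ hα))).resolve_right fun h => hab (smul_left_cancel σ h).symm
  refine ⟨a, σ • a, hab, fun x => ?_⟩
  by_cases hx : aeval (ρ x) q = 0
  · rcases htwo x hx with rfl | rfl
    · rw [Equiv.swap_apply_left]
    · rw [Equiv.swap_apply_right, hba]
  · rw [hlin x hx, Equiv.swap_apply_of_ne_of_ne]
    · rintro rfl
      exact hx hα
    · rintro rfl
      exact hx (hqσ a hα)

end FrobeniusOrbits

section SnCriterion

theorem isCoprime_X_sub_C_of_irreducible {k : Type*} [Field k] {h : k[X]} (hh : Irreducible h)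
    (hd : h.natDegree ≠ 1) (c : k) : IsCoprime (X - C c) h := by
  rw [(irreducible_X_sub_C c).coprime_iff_not_dvd, dvd_iff_isRoot]
  exact fun hc => hd (natDegree_eq_of_degree_eq_some (degree_eq_one_of_irreducible_of_root hh hc))

theorem IsLinearMulIrreducible.separable {k : Type*} [Field k] [PerfectField k] {g : k[X]}
    (hg : IsLinearMulIrreducible g) : g.Separable := by
  obtain ⟨c, h, -, hh, hd, rfl⟩ := hg
  exact (separable_X_sub_C).mul (PerfectField.separable_of_irreducible hh)
    (isCoprime_X_sub_C_of_irreducible hh hd c)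

theorem IsQuadraticMulLinears.separable {k : Type*} [Field k] [PerfectField k] {g : k[X]}
    (hg : IsQuadraticMulLinears g) : g.Separable := by
  obtain ⟨s, q, -, hq, hd, rfl⟩ := hg
  refine (PerfectField.separable_of_irreducible hq).mul
    (separable_prod_X_sub_C_iff'.mpr fun x _ y _ h => h) ?_
  exact IsCoprime.prod_right fun c _ => (isCoprime_X_sub_C_of_irreducible hq (by omega) c).symm

variable {p₁ p₂ p₃ : ℕ} [hp₁ : Fact p₁.Prime] [hp₂ : Fact p₂.Prime] [hp₃ : Fact p₃.Prime]

theorem isSnPoly_of_isSplittingField {n : ℕ} (a : Fin n → ℤ)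
    (K : Type) [Field K] [NumberField K] [IsSplittingField ℚ K (ratPoly n a)]
    (h1 : Irreducible ((intPoly n a).map (Int.castRingHom (ZMod p₁))))
    (h2 : n = 2 ∨ IsLinearMulIrreducible ((intPoly n a).map (Int.castRingHom (ZMod p₂))))
    (h3 : IsQuadraticMulLinears ((intPoly n a).map (Int.castRingHom (ZMod p₃)))) :
    IsSnPoly n a := by
  have hf : (intPoly n a).Monic := monicOfCoeffs_monic n a
  have hfn : (intPoly n a).natDegree = n := natDegree_monicOfCoeffs n a
  have : Normal ℚ K := Normal.of_isSplittingField (ratPoly n a)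
  have : IsGalois ℚ K := IsGalois.mk
  have hsplit : ((ratPoly n a).map (algebraMap ℚ K)).Splits := IsSplittingField.splits K _
  obtain ⟨k₁, _, _, _, σ₁, ρ₁, hρ₁, hσ₁, hF₁⟩ :=
    exists_frobenius hf (PerfectField.separable_of_irreducible h1) K hsplit
  obtain ⟨k₃, _, _, _, σ₃, ρ₃, hρ₃, hσ₃, hF₃⟩ := exists_frobenius hf h3.separable K hsplit
  have hcard : Fintype.card ((ratPoly n a).rootSet K) = n := by
    have := congrArg natDegree hF₁
    rw [natDegree_prod_of_monic _ _ fun x _ => monic_X_sub_C _, (hf.map _).natDegree_map,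
      hf.natDegree_map, hfn] at this
    simp only [natDegree_X_sub_C, Finset.sum_const, smul_eq_mul, mul_one, Finset.card_univ] at this
    exact this.symm
  have hsurj : Function.Surjective
      (MulAction.toPermHom (K ≃ₐ[ℚ] K) ((ratPoly n a).rootSet K)) := by
    refine toPermHom_surjective_of_swap ?_ ?_ ?_
    · intro x y
      obtain ⟨i, hi⟩ := exists_smul_eq_of_irreducible hρ₁ hσ₁ h1
        ((aeval_eq_zero_iff_mem_range hF₁ (ρ₁ x)).mpr ⟨x, rfl⟩)
        ((aeval_eq_zero_iff_mem_range hF₁ (ρ₁ y)).mpr ⟨y, rfl⟩)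
      exact ⟨_, hi⟩
    · rcases h2 with rfl | h2
      · obtain ⟨z, w, hzw, hu⟩ := Finset.card_eq_two.mp (Finset.card_univ.trans hcard)
        have hall : ∀ x, x = z ∨ x = w := fun x => by
          have := Finset.mem_univ x
          rwa [hu, Finset.mem_insert, Finset.mem_singleton] at this
        refine ⟨z, fun x y hx hy => ⟨1, one_smul _ _, ?_⟩⟩
        rw [one_smul, (hall x).resolve_left hx, (hall y).resolve_left hy]
      · obtain ⟨k₂, _, _, _, σ₂, ρ₂, hρ₂, hσ₂, hF₂⟩ :=
          exists_frobenius hf h2.separable K hsplit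
        exact exists_stabilizer_transitive hρ₂ hσ₂ hF₂ h2
    · exact ⟨σ₃, exists_smul_eq_swap hρ₃ hσ₃ hF₃ h3⟩
  have hinj : Function.Injective
      (MulAction.toPermHom (K ≃ₐ[ℚ] K) ((ratPoly n a).rootSet K)) := by
    intro σ τ h
    have hadj : (AlgHom.equalizer σ.toAlgHom τ.toAlgHom) = ⊤ := by
      rw [eq_top_iff, ← IsSplittingField.adjoin_rootSet K (ratPoly n a), Algebra.adjoin_le_iff]
      intro x hx
      have := congrArg Subtype.val
        (DFunLike.congr_fun h (⟨x, hx⟩ : (ratPoly n a).rootSet K))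
      exact this
    refine AlgEquiv.ext fun x => ?_
    exact (AlgHom.mem_equalizer σ.toAlgHom τ.toAlgHom x).mp (hadj ▸ Algebra.mem_top)
  exact ⟨((AlgEquiv.autCongr (IsSplittingField.algEquiv K (ratPoly n a))).symm.trans
    (MulEquiv.ofBijective _ ⟨hinj, hsurj⟩)).trans
    (Fintype.equivFinOfCardEq hcard).permCongrHom⟩

/-- A polynomial whose reductions are, modulo suitable primes, irreducible, a linear factor times
an irreducible polynomial, and a quadratic polynomial times distinct linear factors, is an
`S_n`-polynomial. -/
theorem isSnPoly_of_reductions {n : ℕ} (a : Fin n → ℤ)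
    (h1 : Irreducible ((intPoly n a).map (Int.castRingHom (ZMod p₁))))
    (h2 : n = 2 ∨ IsLinearMulIrreducible ((intPoly n a).map (Int.castRingHom (ZMod p₂))))
    (h3 : IsQuadraticMulLinears ((intPoly n a).map (Int.castRingHom (ZMod p₃)))) :
    IsSnPoly n a := by
  let K := (ratPoly n a).SplittingField
  have hsf : @IsSplittingField ℚ K _ _ DivisionRing.toRatAlgebra (ratPoly n a) := by
    rw [Subsingleton.elim (DivisionRing.toRatAlgebra : Algebra ℚ K)
      (SplittingField.instAlgebra (ratPoly n a))]
    exact IsSplittingField.splittingField _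
  have : NumberField K :=
    { to_charZero := SplittingField.instCharZero _
      to_finiteDimensional := IsSplittingField.finiteDimensional K (ratPoly n a) }
  exact isSnPoly_of_isSplittingField a K h1 h2 h3

end SnCriterion

section Discriminant

open NumberField

/-- The discriminant of a number field divides that of any power basis with integral generator;
hence it divides a power of any constant in the ideal generated by `f` and `f'`. -/
theorem numberField_discr_dvd_pow (L : Type*) [Field L] [NumberField L] (B : PowerBasis ℚ L)
    {f u v : ℤ[X]} (hf : f.Monic) (hB : minpoly ℚ B.gen = f.map (Int.castRingHom ℚ)) {r : ℤ}
    (hr : f * u + derivative f * v = C r) : NumberField.discr L ∣ r ^ B.dim := by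
  have hαf : aeval B.gen f = 0 := by
    have := minpoly.aeval ℚ B.gen
    rwa [hB, ← algebraMap_int_eq, aeval_map_algebraMap] at this
  have hαint : IsIntegral ℤ B.gen := ⟨f, hf, hαf⟩
  let e : Module.Free.ChooseBasisIndex ℤ (𝓞 L) ≃ Fin B.dim := (integralBasis L).indexEquiv B.basis
  let b := (integralBasis L).reindex e
  have hdisc : (NumberField.discr L : ℚ) = Algebra.discr ℚ b := by
    rw [coe_discr, Module.Basis.coe_reindex, Algebra.discr_reindex]
  have hchange : Algebra.discr ℚ B.basis = (b.toMatrix B.basis).det ^ 2 * Algebra.discr ℚ b := by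
    rw [← Algebra.discr_of_matrix_vecMul, Module.Basis.toMatrix_map_vecMul]
  have hdet : IsIntegral ℤ (b.toMatrix B.basis).det := by
    refine IsIntegral.det fun i j => ?_
    obtain ⟨y, hy⟩ : ∃ y : 𝓞 L, algebraMap (𝓞 L) L y = B.basis j :=
      ⟨⟨B.basis j, by rw [PowerBasis.basis_eq_pow]; exact hαint.pow j⟩, rfl⟩
    rw [Module.Basis.toMatrix_apply, Module.Basis.repr_reindex_apply, ← hy,
      integralBasis_repr_apply]
    exact isIntegral_algebraMap
  obtain ⟨m, hm⟩ := IsIntegrallyClosed.isIntegral_iff.mp hdet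
  have hnormint : IsIntegral ℤ (Algebra.norm ℚ (aeval B.gen v)) := by
    refine Algebra.isIntegral_norm ℚ ?_
    exact (IsIntegral.of_mem_of_fg _ hαint.fg_adjoin_singleton _
      (aeval_mem_adjoin_singleton ℤ B.gen))
  obtain ⟨w, hw⟩ := IsIntegrallyClosed.isIntegral_iff.mp hnormint
  have hnorm : Algebra.norm ℚ (aeval B.gen (derivative f)) * Algebra.norm ℚ (aeval B.gen v) =
      (r : ℚ) ^ B.dim := by
    have h1 := congrArg (aeval B.gen) hr
    rw [map_add, map_mul, map_mul, hαf, zero_mul, zero_add, aeval_C] at h1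
    rw [← map_mul, h1, eq_intCast, ← map_intCast (algebraMap ℚ L), Algebra.norm_algebraMap,
      B.finrank]
  have hpb := Algebra.discr_powerBasis_eq_norm ℚ B
  rw [hB, derivative_map, ← algebraMap_int_eq, aeval_map_algebraMap] at hpb
  refine ⟨m ^ 2 * (-1) ^ (Module.finrank ℚ L * (Module.finrank ℚ L - 1) / 2) * w, ?_⟩
  rw [← Int.cast_inj (α := ℚ)]
  push_cast
  rw [eq_intCast] at hm hw
  rw [← hnorm, hdisc, hm, hw]
  rw [hchange] at hpb
  generalize Module.finrank ℚ L * (Module.finrank ℚ L - 1) / 2 = d at hpb ⊢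
  have hsq : (-1 : ℚ) ^ d * (-1) ^ d = 1 := by rw [← mul_pow]; norm_num
  linear_combination (-Algebra.norm ℚ (aeval B.gen (derivative f)) *
    Algebra.norm ℚ (aeval B.gen v)) * hsq - (-1 : ℚ) ^ d * Algebra.norm ℚ (aeval B.gen v) * hpb

theorem resultant_derivative_ne_zero {k : Type*} [Field k] {f : k[X]} {n : ℕ} (hf : f.Monic)
    (hn : f.natDegree = n) (hsep : f.Separable) : resultant f (derivative f) n n ≠ 0 := by
  obtain ⟨d, hd⟩ := Nat.exists_eq_add_of_le
    ((natDegree_derivative_le f).trans (Nat.sub_le _ _) : (derivative f).natDegree ≤ f.natDegree)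
  subst hn
  conv_lhs => enter [4]; rw [hd]
  rw [resultant_add_right_deg _ _ _ _ _ le_rfl]
  refine mul_ne_zero ?_ ((isUnit_resultant_iff_isCoprime hf).mpr hsep).ne_zero
  rw [hf.coeff_natDegree, one_pow]
  exact one_ne_zero

/-- The resultant of `f` and `f'`, which is the discriminant of `f` up to sign. -/
def derivResultant (n : ℕ) (a : Fin n → ℤ) : ℤ :=
  resultant (intPoly n a) (derivative (intPoly n a)) n n

theorem derivResultant_map {n : ℕ} (a : Fin n → ℤ) {R : Type*} [CommRing R] (φ : ℤ →+* R) :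
    φ (derivResultant n a) =
      resultant ((intPoly n a).map φ) (derivative ((intPoly n a).map φ)) n n := by
  rw [derivResultant, ← resultant_map_map, derivative_map]

theorem fieldDisc_dvd_derivResultant_pow {n : ℕ} (hn : n ≠ 0) {a : Fin n → ℤ}
    (ha : Irreducible (ratPoly n a)) : fieldDisc n a ∣ derivResultant n a ^ n := by
  have hf : (intPoly n a).Monic := monicOfCoeffs_monic n a
  have hfn : (intPoly n a).natDegree = n := natDegree_monicOfCoeffs n a
  have : Fact (Irreducible (ratPoly n a)) := ⟨ha⟩
  have hg : (ratPoly n a).Monic := hf.map _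
  obtain ⟨u, v, -, -, huv⟩ := exists_mul_add_mul_eq_C_resultant (intPoly n a)
    (derivative (intPoly n a)) hfn.le
    ((natDegree_derivative_le _).trans ((Nat.sub_le _ _).trans hfn.le)) (Or.inl hn)
  obtain ⟨B, hBdim, hB⟩ : ∃ B : @PowerBasis ℚ (AdjoinRoot (ratPoly n a)) _ _
      DivisionRing.toRatAlgebra, B.dim = n ∧
      @minpoly ℚ (AdjoinRoot (ratPoly n a)) _ _ DivisionRing.toRatAlgebra B.gen =
        (intPoly n a).map (Int.castRingHom ℚ) := by
    rw [Subsingleton.elim (DivisionRing.toRatAlgebra : Algebra ℚ (AdjoinRoot (ratPoly n a)))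
      (AdjoinRoot.instAlgebra (ratPoly n a))]
    refine ⟨AdjoinRoot.powerBasis ha.ne_zero, ?_, ?_⟩
    · rw [AdjoinRoot.powerBasis_dim, ratPoly, hf.natDegree_map, hfn]
    · rw [AdjoinRoot.minpoly_powerBasis_gen_of_monic hg]
      rfl
  have := numberField_discr_dvd_pow (AdjoinRoot (ratPoly n a)) B hf hB huv
  rw [hBdim] at this
  rwa [fieldDisc, dif_pos ha]

end Discriminant

section RamifiedPrimes

theorem not_squarefree_of_mem_primeFactors_fieldDisc {n p : ℕ} (hn : n ≠ 0) {a : Fin n → ℤ}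
    (hp : p ∈ (fieldDisc n a).natAbs.primeFactors) :
    ¬ Squarefree ((intPoly n a).map (Int.castRingHom (ZMod p))) := by
  obtain ⟨hpp, hpd, hne⟩ := Nat.mem_primeFactors.mp hp
  have : Fact p.Prime := ⟨hpp⟩
  have ha : Irreducible (ratPoly n a) := by
    by_contra ha
    exact hne (by rw [fieldDisc, dif_neg ha, Int.natAbs_zero])
  intro hsq
  have h1 := resultant_derivative_ne_zero ((monicOfCoeffs_monic n a).map _)
    (((monicOfCoeffs_monic n a).natDegree_map _).trans (natDegree_monicOfCoeffs n a))
    (PerfectField.separable_iff_squarefree.mpr hsq)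
  rw [← intPoly_eq_monicOfCoeffs, ← derivResultant_map] at h1
  refine h1 ?_
  have h2 : (p : ℤ) ∣ derivResultant n a ^ n :=
    (Int.natCast_dvd.mpr hpd).trans (fieldDisc_dvd_derivResultant_pow hn ha)
  rw [eq_intCast, ZMod.intCast_zmod_eq_zero_iff_dvd]
  exact (Nat.prime_iff_prime_int.mp hpp).dvd_of_dvd_pow h2

theorem derivResultant_ne_zero {n : ℕ} {a : Fin n → ℤ} (ha : Irreducible (ratPoly n a)) :
    derivResultant n a ≠ 0 := by
  have h1 := resultant_derivative_ne_zero ((monicOfCoeffs_monic n a).map (Int.castRingHom ℚ))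
    (((monicOfCoeffs_monic n a).natDegree_map _).trans (natDegree_monicOfCoeffs n a))
    (PerfectField.separable_of_irreducible ha)
  rw [← intPoly_eq_monicOfCoeffs, ← derivResultant_map] at h1
  rintro h
  exact h1 (by rw [h, map_zero])

theorem abs_coeff_intPoly_le {n N : ℕ} (hN : 1 ≤ N) {a : Fin n → ℤ} (ha : a ∈ coeffBox n N)
    (i : ℕ) : |(intPoly n a).coeff i| ≤ N := by
  rw [coeffBox, Fintype.mem_piFinset] at ha
  have hd : (intPoly n a).natDegree = n := natDegree_monicOfCoeffs n a
  rcases lt_trichotomy i n with hi | rfl | hi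
  · have h1 := coeff_monicOfCoeffs n a ⟨i, hi⟩
    rw [intPoly_eq_monicOfCoeffs, show i = ((⟨i, hi⟩ : Fin n) : ℕ) from rfl, h1, abs_le]
    exact Finset.mem_Icc.mp (ha ⟨i, hi⟩)
  · have h1 : (intPoly i a).coeff (intPoly i a).natDegree = 1 :=
      (monicOfCoeffs_monic i a).coeff_natDegree
    rw [hd] at h1
    rw [h1, abs_one]
    exact_mod_cast hN
  · rw [coeff_eq_zero_of_natDegree_lt (by omega), abs_zero]
    positivity

theorem abs_derivResultant_le {n N : ℕ} (hn : 1 ≤ n) (hN : 1 ≤ N) {a : Fin n → ℤ}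
    (ha : a ∈ coeffBox n N) :
    |derivResultant n a| ≤ (2 * n).factorial * (n * N : ℤ) ^ (2 * n) := by
  have hd : (intPoly n a).natDegree = n := natDegree_monicOfCoeffs n a
  have hn' : (1 : ℤ) ≤ n := by exact_mod_cast hn
  have hle : (N : ℤ) ≤ n * N := by nlinarith [Int.natCast_nonneg N]
  have h1 : ∀ i, |(intPoly n a).coeff i| ≤ n * N := fun i =>
    (abs_coeff_intPoly_le hN ha i).trans hle
  have h2 : ∀ i, |(derivative (intPoly n a)).coeff i| ≤ n * N := by
    intro i
    rw [coeff_derivative]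
    by_cases hi : i + 1 ≤ n
    · rw [abs_mul, mul_comm]
      have hi' : |((i : ℤ) + 1)| ≤ n := by
        rw [abs_of_nonneg (by positivity)]
        exact_mod_cast hi
      exact mul_le_mul hi' (abs_coeff_intPoly_le hN ha _) (abs_nonneg _) (by positivity)
    · rw [coeff_eq_zero_of_natDegree_lt (by omega), zero_mul, abs_zero]
      positivity
  have h0 : |(0 : ℤ)| ≤ n * N := by
    rw [abs_zero]
    positivity
  have h3 := Matrix.det_le (abv := AbsoluteValue.abs)
    (A := sylvester (intPoly n a) (derivative (intPoly n a)) n n) (x := (n * N : ℤ)) (by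
      intro i j
      rw [AbsoluteValue.abs_apply, sylvester, Matrix.of_apply]
      refine Fin.addCases (fun j => ?_) (fun j => ?_) j
      · rw [Fin.addCases_left]
        split_ifs
        exacts [h2 _, h0]
      · rw [Fin.addCases_right]
        split_ifs
        exacts [h1 _, h0])
  rw [Fintype.card_fin, nsmul_eq_mul] at h3
  rw [two_mul]
  exact h3

theorem card_primeFactors_fieldDisc_filter_lt_le {n N : ℕ} (hn : 1 ≤ n)
    (hN : (2 * n).factorial * n ^ (2 * n) < N) {a : Fin n → ℤ} (ha : a ∈ coeffBox n N) :
    ((fieldDisc n a).natAbs.primeFactors.filter (N < ·)).card ≤ 2 * n := by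
  by_cases hirr : Irreducible (ratPoly n a)
  swap
  · rw [fieldDisc, dif_neg hirr]
    simp
  set S := (fieldDisc n a).natAbs.primeFactors.filter (N < ·) with hS
  have hr := derivResultant_ne_zero hirr
  have hSdvd : ∏ p ∈ S, p ∣ (derivResultant n a).natAbs := by
    refine Finset.prod_primes_dvd _ ?_ ?_
    · intro p hp
      exact (Nat.prime_of_mem_primeFactors (Finset.mem_filter.mp hp).1).prime
    · intro p hp
      obtain ⟨hpp, hpd, -⟩ := Nat.mem_primeFactors.mp (Finset.mem_filter.mp hp).1
      refine hpp.dvd_of_dvd_pow (n := n) (hpd.trans ?_)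
      rw [← Int.natAbs_pow]
      exact Int.natAbs_dvd_natAbs.mpr (fieldDisc_dvd_derivResultant_pow (by omega) hirr)
  have hlow : N ^ S.card ≤ ∏ p ∈ S, p :=
    Finset.pow_card_le_prod S (fun p => p) N fun p hp => (Finset.mem_filter.mp hp).2.le
  have hup : (derivResultant n a).natAbs < N ^ (2 * n + 1) := by
    have h1 := abs_derivResultant_le hn (by omega) ha
    rw [Int.abs_eq_natAbs] at h1
    have h2 : (derivResultant n a).natAbs ≤ (2 * n).factorial * (n * N) ^ (2 * n) := by
      exact_mod_cast h1
    refine h2.trans_lt ?_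
    rw [mul_pow, ← mul_assoc, pow_succ']
    exact Nat.mul_lt_mul_of_pos_right hN (pow_pos (by omega) _)
  have hlt := (hlow.trans (Nat.le_of_dvd (Int.natAbs_pos.mpr hr) hSdvd)).trans_lt hup
  by_contra! hcard
  exact absurd hlt (not_lt.mpr (Nat.pow_le_pow_right (by omega) hcard))

end RamifiedPrimes

section GenericGaloisGroup

theorem exists_finset_primes_card_eq (m : ℕ) (hm : m ≠ 0) (K : ℕ) :
    ∃ S : Finset ℕ, S.card = K ∧ ∀ p ∈ S, p.Prime ∧ m < p ∧ p ≤ m * 2 ^ K := by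
  induction K with
  | zero => exact ⟨∅, rfl, by simp⟩
  | succ K ih =>
    obtain ⟨S, hcard, hS⟩ := ih
    obtain ⟨q, hq, hlt, hle⟩ := Nat.exists_prime_lt_and_le_two_mul (m * 2 ^ K) (by positivity)
    have hmK : m ≤ m * 2 ^ K := Nat.le_mul_of_pos_right m (by positivity)
    have hqS : q ∉ S := fun h => absurd (hS q h).2.2 (not_le.mpr hlt)
    refine ⟨insert q S, by rw [card_insert_of_notMem hqS, hcard], fun p hp => ?_⟩
    have h2 : m * 2 ^ (K + 1) = 2 * (m * 2 ^ K) := by ring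
    rcases mem_insert.mp hp with rfl | hp
    · exact ⟨hq, hmK.trans_lt hlt, h2 ▸ hle⟩
    · obtain ⟨h1, h3, h4⟩ := hS p hp
      exact ⟨h1, h3, by omega⟩

/-- The coefficient vectors whose reductions avoid, for each prime of `S`, a set of
polynomials of density at least `1 / c`. -/
theorem card_coeffBox_filter_forall_not_le (n N : ℕ) (S : Finset ℕ) (hS : ∀ p ∈ S, p.Prime)
    (hSN : ∏ p ∈ S, p ≤ 2 * N + 1) (T : ∀ p : ℕ, (ZMod p)[X] → Prop) (c : ℕ)
    (hT : ∀ p ∈ S, ∀ _ : Fact p.Prime, p ^ n ≤ c * ((univ : Finset (Fin n → ZMod p)).filter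
      fun b => T p (monicOfCoeffs n b)).card) :
    (((coeffBox n N).filter fun a => ∀ p ∈ S,
      ¬ T p ((intPoly n a).map (Int.castRingHom (ZMod p)))).card : ℝ) ≤
      2 ^ n * (2 * N + 1 : ℝ) ^ n * (1 - 1 / c : ℝ) ^ S.card := by
  let B : ∀ p : ℕ, Finset (Fin n → ZMod p) := fun p =>
    if hp : p.Prime then
      haveI : Fact p.Prime := ⟨hp⟩
      univ.filter fun b => ¬ T p (monicOfCoeffs n b)
    else ∅
  have hB : ∀ p ∈ S, ((B p).card : ℝ) ≤ (1 - 1 / c : ℝ) * (p : ℝ) ^ n := by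
    intro p hp
    have hF : Fact p.Prime := ⟨hS p hp⟩
    have h1 : (B p) = univ.filter fun b => ¬ T p (monicOfCoeffs n b) := dif_pos (hS p hp)
    have h2 := hT p hp hF
    have h3 : ((univ : Finset (Fin n → ZMod p)).filter fun b => T p (monicOfCoeffs n b)).card +
        (B p).card = p ^ n := by
      rw [h1, card_filter_add_card_filter_not]
      simp
    have hp0 : 0 < p ^ n := pow_pos (hS p hp).pos n
    have hc : 0 < c := by
      rcases Nat.eq_zero_or_pos c with rfl | h
      · omega
      · exact h
    have hc' : (0 : ℝ) < c := by exact_mod_cast hc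
    have h2' : (p : ℝ) ^ n ≤ c * (((univ : Finset (Fin n → ZMod p)).filter
        fun b => T p (monicOfCoeffs n b)).card : ℝ) := by exact_mod_cast h2
    have h3' : (((univ : Finset (Fin n → ZMod p)).filter
        fun b => T p (monicOfCoeffs n b)).card : ℝ) + ((B p).card : ℝ) = (p : ℝ) ^ n := by
      exact_mod_cast h3
    have h4 := (div_le_iff₀' hc').mpr h2'
    rw [sub_mul, one_mul, one_div_mul_eq_div]
    linarith
  have hQ : 0 < ∏ p ∈ S, p := Finset.prod_pos fun p hp => (hS p hp).pos
  set Q := ∏ p ∈ S, p with hQdef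
  have hQ' : (0 : ℝ) < Q := by exact_mod_cast hQ
  have hQN : (Q : ℝ) ≤ 2 * N + 1 := by exact_mod_cast hSN
  have key := card_coeffBox_filter_residues_le n N S hS B
  have hsub : ((coeffBox n N).filter fun a => ∀ p ∈ S,
      ¬ T p ((intPoly n a).map (Int.castRingHom (ZMod p)))) ⊆
      (coeffBox n N).filter fun a => ∀ p ∈ S, (fun i => (a i : ZMod p)) ∈ B p := by
    intro a ha
    rw [mem_filter] at ha ⊢
    refine ⟨ha.1, fun p hp => ?_⟩
    have hF : Fact p.Prime := ⟨hS p hp⟩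
    have h1 : (B p) = univ.filter fun b => ¬ T p (monicOfCoeffs n b) := dif_pos (hS p hp)
    have h2 := ha.2 p hp
    rw [intPoly_eq_monicOfCoeffs, map_monicOfCoeffs] at h2
    rw [h1, mem_filter]
    exact ⟨mem_univ _, h2⟩
  have h1 : ((2 * N + 1 : ℝ) / Q + 1) ^ n ≤ (2 * ((2 * N + 1 : ℝ) / Q)) ^ n := by
    refine pow_le_pow_left₀ (by positivity) ?_ n
    have := (one_le_div hQ').mpr hQN
    linarith
  have h2 : ∏ p ∈ S, ((B p).card : ℝ) ≤ (1 - 1 / c : ℝ) ^ S.card * (Q : ℝ) ^ n := by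
    refine (Finset.prod_le_prod (fun _ _ => Nat.cast_nonneg _) hB).trans_eq ?_
    rw [Finset.prod_mul_distrib, Finset.prod_const, Finset.prod_pow, hQdef]
    push_cast
    rfl
  calc _ ≤ _ := Nat.cast_le.mpr (card_le_card hsub)
    _ ≤ _ := key
    _ ≤ (2 * ((2 * N + 1 : ℝ) / Q)) ^ n * ((1 - 1 / c : ℝ) ^ S.card * (Q : ℝ) ^ n) :=
      mul_le_mul h1 h2 (Finset.prod_nonneg fun _ _ => Nat.cast_nonneg _) (by positivity)
    _ = _ := by
      rw [mul_pow, div_pow]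
      field_simp

theorem one_sub_inv_pow_mul_le (c K : ℕ) (hc : 1 ≤ c) :
    (1 - 1 / c : ℝ) ^ K * K ≤ c := by
  have hc' : (1 : ℝ) ≤ c := by exact_mod_cast hc
  have hx : (0 : ℝ) ≤ 1 / c := by positivity
  have hx1 : (1 : ℝ) / c ≤ 1 := (div_le_one (by positivity)).mpr hc'
  have h1 : (1 : ℝ) + K * (1 / c) ≤ (1 + 1 / c) ^ K :=
    one_add_mul_le_pow (by linarith) K
  have h2 : (1 - 1 / c : ℝ) ^ K * (1 + K * (1 / c)) ≤ 1 := by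
    refine (mul_le_mul_of_nonneg_left h1 (pow_nonneg (by linarith) K)).trans ?_
    rw [← mul_pow]
    exact pow_le_one₀ (mul_nonneg (by linarith) (by linarith)) (by nlinarith)
  have h3 : (0 : ℝ) ≤ (1 - 1 / c : ℝ) ^ K := pow_nonneg (by linarith) K
  have h4 : (1 - 1 / c : ℝ) ^ K * K = c * ((1 - 1 / c : ℝ) ^ K * (K * (1 / c))) := by
    field_simp
  rw [h4]
  nlinarith

/-- Almost all monic integer polynomials have Galois group `S_n`, with a bound for the
exceptional set decaying like `1 / K` as soon as `N` is at least doubly exponential in `K`. -/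
theorem exists_card_coeffBox_sub_card_P0_le (n : ℕ) (hn : 2 ≤ n) :
    ∃ D > (0 : ℝ), ∃ K₀ : ℕ, ∀ K N : ℕ, K₀ ≤ K → 2 ^ 2 ^ K ≤ N →
      (((coeffBox n N).card : ℝ) - (P0 n N).card) * K ≤ D * (coeffBox n N).card := by
  refine ⟨2 ^ n * (2 * n + 2 * n + 2 ^ n * n.factorial : ℕ), by positivity, 2 * n + 7,
    fun K N hK hN => ?_⟩
  obtain ⟨S, hcard, hS⟩ := exists_finset_primes_card_eq (2 * n) (by omega) K
  have hSp : ∀ p ∈ S, p.Prime := fun p hp => (hS p hp).1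
  have hSN : ∏ p ∈ S, p ≤ 2 * N + 1 := by
    have h1 : ∏ p ∈ S, p ≤ (2 * n * 2 ^ K) ^ K := by
      rw [← hcard]
      refine Finset.prod_le_pow_card S (fun p => p) _ fun p hp => ?_
      rw [hcard]
      exact (hS p hp).2.2
    have h2 : 2 * n * 2 ^ K ≤ 2 ^ (2 * K) := by
      rw [two_mul K, pow_add]
      exact Nat.mul_le_mul_right _ ((by omega : 2 * n ≤ K).trans Nat.lt_two_pow_self.le)
    have h3 : ∀ k, 7 ≤ k → 2 * k * k ≤ 2 ^ k := by
      intro k hk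
      induction k, hk using Nat.le_induction with
      | base => norm_num
      | succ k hk ih =>
        rw [pow_succ]
        nlinarith
    have h4 : (2 * n * 2 ^ K) ^ K ≤ 2 ^ 2 ^ K := by
      refine (Nat.pow_le_pow_left h2 K).trans ?_
      rw [← pow_mul]
      exact Nat.pow_le_pow_right (by norm_num) (h3 K (by omega))
    omega
  obtain ⟨T₁, hT₁⟩ : ∃ T : ∀ p : ℕ, (ZMod p)[X] → Prop, ∀ p g, T p g ↔ Irreducible g :=
    ⟨fun p g => Irreducible g, fun _ _ => Iff.rfl⟩
  obtain ⟨T₂, hT₂⟩ : ∃ T : ∀ p : ℕ, (ZMod p)[X] → Prop,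
      ∀ (p : ℕ) (_ : Fact p.Prime) (g : (ZMod p)[X]), T p g ↔ n = 2 ∨ IsLinearMulIrreducible g :=
    ⟨fun p g => ∀ _ : Fact p.Prime, n = 2 ∨ IsLinearMulIrreducible g,
      fun _ hF _ => ⟨fun h => h hF, fun h _ => h⟩⟩
  obtain ⟨T₃, hT₃⟩ : ∃ T : ∀ p : ℕ, (ZMod p)[X] → Prop,
      ∀ (p : ℕ) (_ : Fact p.Prime) (g : (ZMod p)[X]), T p g ↔ IsQuadraticMulLinears g :=
    ⟨fun p g => ∀ _ : Fact p.Prime, IsQuadraticMulLinears g,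
      fun _ hF _ => ⟨fun h => h hF, fun h _ => h⟩⟩
  have H₁ := card_coeffBox_filter_forall_not_le n N S hSp hSN T₁ (2 * n) fun p hp hF => by
    simp only [hT₁]
    exact pow_le_mul_card_irreducible p n (by omega) (hS p hp).2.1.le
  have H₂ := card_coeffBox_filter_forall_not_le n N S hSp hSN T₂ (2 * n) fun p hp hF => by
    rcases hn.eq_or_lt with h | h
    · have : ((univ : Finset (Fin n → ZMod p)).filter fun b => T₂ p (monicOfCoeffs n b)) =
          univ := filter_true_of_mem fun _ _ => (hT₂ p hF _).mpr (Or.inl h.symm)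
      rw [this]
      simp only [card_univ, Fintype.card_pi, ZMod.card, prod_const, Fintype.card_fin]
      exact Nat.le_mul_of_pos_left _ (by omega)
    · refine (pow_le_mul_card_linearMulIrreducible p n h (hS p hp).2.1.le).trans
        (Nat.mul_le_mul_left _ (card_le_card fun b hb => ?_))
      rw [mem_filter] at hb ⊢
      exact ⟨hb.1, (hT₂ p hF _).mpr (Or.inr hb.2)⟩
  have H₃ := card_coeffBox_filter_forall_not_le n N S hSp hSN T₃ (2 ^ n * n.factorial)
    fun p hp hF => by
      refine (pow_le_mul_card_quadraticMulLinears p n hn (hS p hp).2.1.le).trans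
        (Nat.mul_le_mul_left _ (card_le_card fun b hb => ?_))
      rw [mem_filter] at hb ⊢
      exact ⟨hb.1, (hT₃ p hF _).mpr hb.2⟩
  have hsub : (coeffBox n N).filter (fun a => ¬ IsSnPoly n a) ⊆
      ((coeffBox n N).filter fun a => ∀ p ∈ S,
        ¬ T₁ p ((intPoly n a).map (Int.castRingHom (ZMod p)))) ∪
      ((coeffBox n N).filter fun a => ∀ p ∈ S,
        ¬ T₂ p ((intPoly n a).map (Int.castRingHom (ZMod p)))) ∪
      ((coeffBox n N).filter fun a => ∀ p ∈ S,
        ¬ T₃ p ((intPoly n a).map (Int.castRingHom (ZMod p)))) := by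
    intro a ha
    rw [mem_filter] at ha
    rw [mem_union, mem_union, mem_filter, mem_filter, mem_filter]
    by_contra! hcon
    obtain ⟨⟨c1, c2⟩, c3⟩ := hcon
    obtain ⟨p₁, hp₁, t1⟩ := c1 ha.1
    obtain ⟨p₂, hp₂, t2⟩ := c2 ha.1
    obtain ⟨p₃, hp₃, t3⟩ := c3 ha.1
    have : Fact p₁.Prime := ⟨hSp _ hp₁⟩
    have : Fact p₂.Prime := ⟨hSp _ hp₂⟩
    have : Fact p₃.Prime := ⟨hSp _ hp₃⟩
    exact ha.2 (isSnPoly_of_reductions (p₁ := p₁) (p₂ := p₂) (p₃ := p₃) a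
      ((hT₁ _ _).mp t1) ((hT₂ _ ‹_› _).mp t2) ((hT₃ _ ‹_› _).mp t3))
  have hcomp : ((coeffBox n N).card : ℝ) - (P0 n N).card =
      ((coeffBox n N).filter fun a => ¬ IsSnPoly n a).card := by
    rw [sub_eq_iff_eq_add', P0]
    exact_mod_cast (card_filter_add_card_filter_not (s := coeffBox n N) (IsSnPoly n)).symm
  have hle := (card_le_card hsub).trans ((card_union_le _ _).trans
    (Nat.add_le_add_right (card_union_le _ _) _))
  have hle' := (Nat.cast_le (α := ℝ)).mpr hle
  push_cast at hle'
  rw [hcomp, card_coeffBox]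
  rw [hcard] at H₁ H₂ H₃
  have g1 := one_sub_inv_pow_mul_le (2 * n) K (by omega)
  have g3 := one_sub_inv_pow_mul_le (2 ^ n * n.factorial) K
    (Nat.one_le_iff_ne_zero.mpr (by positivity))
  have hA : (0 : ℝ) ≤ 2 ^ n * (2 * N + 1 : ℝ) ^ n := by positivity
  have e1 := mul_le_mul_of_nonneg_left g1 hA
  have e3 := mul_le_mul_of_nonneg_left g3 hA
  have hK0 : (0 : ℝ) ≤ K := Nat.cast_nonneg K
  have := mul_le_mul_of_nonneg_right (hle'.trans (add_le_add (add_le_add H₁ H₂) H₃)) hK0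
  refine this.trans ?_
  push_cast at e1 e3 ⊢
  nlinarith

end GenericGaloisGroup

section Average

theorem one_add_pow_le (n : ℕ) {x : ℝ} (hx : 0 ≤ x) (hx1 : x ≤ 1) :
    (1 + x) ^ n ≤ 1 + (2 ^ n - 1) * x := by
  induction n with
  | zero => simp
  | succ n ih =>
    have h2 : (1 : ℝ) ≤ 2 ^ n := one_le_pow₀ (by norm_num)
    have h3 : ((2 : ℝ) ^ n - 1) * x * x ≤ (2 ^ n - 1) * x :=
      mul_le_of_le_one_right (mul_nonneg (by linarith) hx) hx1
    have h4 := mul_le_mul_of_nonneg_right ih (by linarith : (0 : ℝ) ≤ 1 + x)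
    rw [pow_succ, pow_succ (2 : ℝ)]
    linarith

theorem card_coeffBox_filter_not_squarefree_le {n N p : ℕ} (hn : 2 ≤ n) (hp : p.Prime)
    (hpN : p ≤ N) :
    (((coeffBox n N).filter fun a =>
      ¬ Squarefree ((intPoly n a).map (Int.castRingHom (ZMod p)))).card : ℝ) ≤
      (2 * N + 1 : ℝ) ^ n *
        (1 / p + n * ((p : ℝ) ^ 2)⁻¹ + 2 ^ n * (n + 1) / (2 * N + 1 : ℝ)) := by
  have hF : Fact p.Prime := ⟨hp⟩
  let B : ∀ q : ℕ, Finset (Fin n → ZMod q) := fun q =>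
    if hq : q.Prime then
      haveI : Fact q.Prime := ⟨hq⟩
      univ.filter fun b => ¬ Squarefree (monicOfCoeffs n b)
    else ∅
  have hB : B p = univ.filter fun b => ¬ Squarefree (monicOfCoeffs n b) := dif_pos hp
  have key := card_coeffBox_filter_residues_le n N {p} (by simpa using hp) B
  have hsub : ((coeffBox n N).filter fun a =>
      ¬ Squarefree ((intPoly n a).map (Int.castRingHom (ZMod p)))) ⊆
      (coeffBox n N).filter fun a => ∀ q ∈ ({p} : Finset ℕ), (fun i => (a i : ZMod q)) ∈ B q := by
    intro a ha
    rw [mem_filter] at ha ⊢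
    refine ⟨ha.1, fun q hq => ?_⟩
    obtain rfl := mem_singleton.mp hq
    have h2 := ha.2
    rw [intPoly_eq_monicOfCoeffs, map_monicOfCoeffs] at h2
    rw [hB, mem_filter]
    exact ⟨mem_univ _, h2⟩
  rw [prod_singleton, prod_singleton] at key
  have hcard : ((B p).card : ℝ) ≤ (p : ℝ) ^ (n - 1) + n * (p : ℝ) ^ (n - 2) := by
    rw [hB]
    exact_mod_cast card_not_squarefree_le p n hn
  have hp1 : (1 : ℝ) ≤ p := by exact_mod_cast hp.one_le
  have hp0 : (0 : ℝ) < p := by linarith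
  set L : ℝ := 2 * N + 1 with hL
  have hpL : (p : ℝ) ≤ L := by
    rw [hL]
    exact_mod_cast hpN.trans (by omega)
  have hL0 : 0 < L := hp0.trans_le hpL
  have h1 : (L / p + 1) ^ n ≤ (L / p) ^ n * (1 + 2 ^ n * (p / L)) := by
    have e : L / p + 1 = L / p * (1 + p / L) := by
      field_simp
    have h := one_add_pow_le n (x := p / L) (by positivity) ((div_le_one hL0).mpr hpL)
    have h0 : 0 ≤ (p : ℝ) / L := by positivity
    rw [e, mul_pow]
    exact mul_le_mul_of_nonneg_left (by linarith) (by positivity)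
  have hpow : (L / p) ^ n * ((p : ℝ) ^ (n - 1) + n * (p : ℝ) ^ (n - 2)) =
      L ^ n * (1 / p + n * ((p : ℝ) ^ 2)⁻¹) := by
    obtain ⟨m, rfl⟩ := Nat.exists_eq_add_of_le' hn
    rw [show m + 2 - 1 = m + 1 by omega, Nat.add_sub_cancel, div_pow]
    field_simp
    ring
  calc _ ≤ _ := Nat.cast_le.mpr (card_le_card hsub)
    _ ≤ _ := key
    _ ≤ (L / p) ^ n * (1 + 2 ^ n * (p / L)) *
        ((p : ℝ) ^ (n - 1) + n * (p : ℝ) ^ (n - 2)) :=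
      mul_le_mul h1 hcard (Nat.cast_nonneg _) (by positivity)
    _ = L ^ n * ((1 / p + n * ((p : ℝ) ^ 2)⁻¹) * (1 + 2 ^ n * (p / L))) := by
      rw [mul_right_comm, hpow, mul_assoc]
    _ ≤ _ := by
      refine mul_le_mul_of_nonneg_left ?_ (by positivity)
      have e : (1 / p + n * ((p : ℝ) ^ 2)⁻¹) * (1 + 2 ^ n * (p / L)) =
          1 / p + n * ((p : ℝ) ^ 2)⁻¹ + 2 ^ n * (n * (1 / p) + 1) / L := by
        field_simp
        ring
      rw [e]
      have h2 : (n : ℝ) * (1 / p) ≤ n :=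
        mul_le_of_le_one_right (Nat.cast_nonneg _) ((div_le_one hp0).mpr hp1)
      gcongr

theorem exists_sum_card_primeFactors_filter_le (n : ℕ) (hn : 2 ≤ n) :
    ∃ C > (0 : ℝ), ∀ N : ℕ, 2 ≤ N →
      ∑ a ∈ P0 n N, (((fieldDisc n a).natAbs.primeFactors.filter (· ≤ N)).card : ℝ) ≤
        (coeffBox n N).card * (Real.log (Real.log N) + C) := by
  obtain ⟨C, hC, hM⟩ := exists_sum_primes_inv_le
  refine ⟨C + n * 2 + 2 ^ n * (n + 1), by positivity, fun N hN => ?_⟩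
  set R := (range (N + 1)).filter Nat.Prime with hR
  have hswap : ∑ a ∈ P0 n N, (((fieldDisc n a).natAbs.primeFactors.filter (· ≤ N)).card : ℝ) ≤
      ∑ p ∈ R, (((coeffBox n N).filter fun a =>
        ¬ Squarefree ((intPoly n a).map (Int.castRingHom (ZMod p)))).card : ℝ) := by
    have h1 : ∀ a ∈ P0 n N, (fieldDisc n a).natAbs.primeFactors.filter (· ≤ N) ⊆
        R.filter fun p => ¬ Squarefree ((intPoly n a).map (Int.castRingHom (ZMod p))) := by
      intro a _ p hp
      rw [mem_filter] at hp
      exact mem_filter.mpr ⟨mem_filter.mpr ⟨mem_range.mpr (by omega),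
        Nat.prime_of_mem_primeFactors hp.1⟩,
        not_squarefree_of_mem_primeFactors_fieldDisc (by omega) hp.1⟩
    have h2 : ∑ a ∈ P0 n N, ((fieldDisc n a).natAbs.primeFactors.filter (· ≤ N)).card ≤
        ∑ p ∈ R, ((coeffBox n N).filter fun a =>
          ¬ Squarefree ((intPoly n a).map (Int.castRingHom (ZMod p)))).card := by
      refine (sum_le_sum fun a ha => card_le_card (h1 a ha)).trans ?_
      refine (sum_le_sum_of_subset (filter_subset _ (coeffBox n N))).trans_eq ?_
      exact sum_card_bipartiteAbove_eq_sum_card_bipartiteBelow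
        (fun (a : Fin n → ℤ) p => ¬ Squarefree ((intPoly n a).map (Int.castRingHom (ZMod p))))
    exact_mod_cast h2
  refine hswap.trans ((sum_le_sum fun p hp => card_coeffBox_filter_not_squarefree_le hn
    (mem_filter.mp hp).2 (Nat.lt_succ_iff.mp (mem_range.mp (mem_filter.mp hp).1))).trans ?_)
  rw [← mul_sum, card_coeffBox]
  push_cast
  refine mul_le_mul_of_nonneg_left ?_ (by positivity)
  rw [sum_add_distrib, sum_add_distrib, ← mul_sum, sum_const, nsmul_eq_mul]
  have hsq : ∑ p ∈ R, ((p : ℝ) ^ 2)⁻¹ ≤ 2 := by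
    have h1 := sum_Ioo_inv_sq_le (α := ℝ) 0 (N + 1)
    have h2 : R ⊆ Ioo 0 (N + 1) := fun p hp => by
      rw [hR, mem_filter, mem_range] at hp
      exact mem_Ioo.mpr ⟨hp.2.pos, hp.1⟩
    refine (sum_le_sum_of_subset_of_nonneg h2 fun _ _ _ => by positivity).trans (h1.trans ?_)
    norm_num
  have hcard : (R.card : ℝ) * (2 ^ n * (n + 1) / (2 * N + 1)) ≤ 2 ^ n * (n + 1) := by
    have h1 : (R.card : ℝ) ≤ 2 * N + 1 := by
      have := (card_filter_le (range (N + 1)) Nat.Prime)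
      rw [card_range] at this
      exact_mod_cast this.trans (by omega)
    rw [mul_div_assoc', div_le_iff₀ (by positivity), mul_comm]
    exact mul_le_mul_of_nonneg_left h1 (by positivity)
  have h3 := mul_le_mul_of_nonneg_left hsq (Nat.cast_nonneg (α := ℝ) n)
  linarith [hM N hN]

theorem log_log_le_of_natLog (N : ℕ) (hN : 2 ≤ N) :
    Real.log (Real.log N) ≤ Nat.log 2 (Nat.log 2 N) + 1 := by
  set K := Nat.log 2 (Nat.log 2 N)
  have h1 : N ≤ 2 ^ 2 ^ (K + 1) :=
    (Nat.lt_pow_succ_log_self (by norm_num) N).le.trans (Nat.pow_le_pow_right (by norm_num)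
      (Nat.lt_pow_succ_log_self (by norm_num) (Nat.log 2 N)))
  have hN' : (2 : ℝ) ≤ N := by exact_mod_cast hN
  have h1' : (N : ℝ) ≤ 2 ^ 2 ^ (K + 1) := by exact_mod_cast h1
  have hl2 : Real.log 2 ≤ 1 := (Real.log_le_sub_one_of_pos (by norm_num)).trans (by norm_num)
  have h2 : Real.log N ≤ 2 ^ (K + 1) := by
    refine (Real.log_le_log (by linarith) h1').trans ?_
    rw [Real.log_pow]
    push_cast
    exact mul_le_of_le_one_right (by positivity) hl2
  refine (Real.log_le_log (Real.log_pos (by linarith)) h2).trans ?_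
  rw [Real.log_pow]
  push_cast
  exact mul_le_of_le_one_right (by positivity) hl2

end Average

/-- **Corollary 5.1**: the average number of ramified primes in `ℚ_f/ℚ`, i.e. of primes
dividing the field discriminant `D_{ℚ_f}`, is at most `log log N + O_n(1)`. -/
theorem average_ramified_primes (n : ℕ) (hn : 2 ≤ n) :
    ∃ C > (0 : ℝ), ∃ N₀ : ℕ, ∀ N : ℕ, N₀ ≤ N →
      expN n N (fun f => (((fieldDisc n f).natAbs.primeFactors.card : ℝ))) ≤
        Real.log (Real.log (N : ℝ)) + C := by
  obtain ⟨C, hC, hsmall⟩ := exists_sum_card_primeFactors_filter_le n hn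
  obtain ⟨D, hD, K₀, hdens⟩ := exists_card_coeffBox_sub_card_P0_le n hn
  set K₁ := max (max K₀ ⌈2 * D⌉₊) 1 with hK₁
  refine ⟨C + 2 * D * (2 + C) + 2 * n, by positivity,
    max (2 ^ 2 ^ K₁) ((2 * n).factorial * n ^ (2 * n) + 1), fun N hN => ?_⟩
  have hN1 : 2 ^ 2 ^ K₁ ≤ N := (le_max_left _ _).trans hN
  have hN2 : (2 * n).factorial * n ^ (2 * n) < N := (le_max_right _ _).trans hN
  have hN0 : 4 ≤ N := by
    refine le_trans ?_ hN1
    have h1 : 2 ^ 1 ≤ 2 ^ K₁ := Nat.pow_le_pow_right (by norm_num) (le_max_right _ _)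
    exact (by norm_num : 4 ≤ 2 ^ 2 ^ 1).trans (Nat.pow_le_pow_right (by norm_num) h1)
  have hlog0 : Nat.log 2 N ≠ 0 := (Nat.log_pos (by norm_num) (by omega)).ne'
  set K := Nat.log 2 (Nat.log 2 N) with hK
  have hKN : 2 ^ 2 ^ K ≤ N :=
    (Nat.pow_le_pow_right (by norm_num) (Nat.pow_log_le_self 2 hlog0)).trans
      (Nat.pow_log_le_self 2 (by omega))
  have hKK : K₁ ≤ K := by
    refine Nat.le_log_of_pow_le (by norm_num) (Nat.le_log_of_pow_le (by norm_num) hN1)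
  have hK0 : K₀ ≤ K := ((le_max_left _ _).trans (le_max_left _ _)).trans hKK
  have hK2 : 2 * D ≤ K := (Nat.le_ceil _).trans (by
    exact_mod_cast ((le_max_right _ _).trans (le_max_left _ _)).trans hKK)
  have hK3 : (1 : ℝ) ≤ K := by exact_mod_cast (le_max_right _ _).trans hKK
  have hd := hdens K N hK0 hKN
  have hs := hsmall N (by omega)
  have hll := log_log_le_of_natLog N (by omega)
  rw [← hK] at hll
  have hbox : (0 : ℝ) < (coeffBox n N).card := by
    rw [card_coeffBox]
    positivity
  set b : ℝ := ((coeffBox n N).card : ℝ)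
  set t : ℝ := ((P0 n N).card : ℝ)
  set y := Real.log (Real.log (N : ℝ))
  have hsum : ∑ a ∈ P0 n N, (((fieldDisc n a).natAbs.primeFactors.card : ℝ)) ≤
      b * (y + C) + 2 * n * t := by
    have h1 : ∀ a ∈ P0 n N, (((fieldDisc n a).natAbs.primeFactors.card : ℝ)) ≤
        (((fieldDisc n a).natAbs.primeFactors.filter (· ≤ N)).card : ℝ) + 2 * n := by
      intro a ha
      have h2 := card_primeFactors_fieldDisc_filter_lt_le (by omega) hN2 (mem_filter.mp ha).1
      have h3 := card_filter_add_card_filter_not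
        (s := (fieldDisc n a).natAbs.primeFactors) (· ≤ N)
      simp only [not_le] at h3
      exact_mod_cast (by omega : (fieldDisc n a).natAbs.primeFactors.card ≤
        ((fieldDisc n a).natAbs.primeFactors.filter (· ≤ N)).card + 2 * n)
    refine (sum_le_sum h1).trans ?_
    rw [sum_add_distrib, sum_const, nsmul_eq_mul]
    linarith
  have hK4 : (0 : ℝ) < K := by linarith
  have hb2 : b ≤ 2 * t := by
    have h1 := mul_le_mul_of_nonneg_left hK2 hbox.le
    refine le_of_mul_le_mul_right ?_ hK4
    linarith
  have ht : 0 < t := by linarith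
  have hbt : (b - t) * K ≤ 2 * D * t :=
    hd.trans (by linarith [mul_le_mul_of_nonneg_left hb2 hD.le])
  have htb : 0 ≤ b - t := sub_nonneg.mpr (Nat.cast_le.mpr (card_filter_le _ _))
  have hmain : (b - t) * (y + C) ≤ 2 * D * (2 + C) * t := by
    have h1 : y + C ≤ K * (2 + C) := by
      linarith [mul_le_mul_of_nonneg_right hK3 hC.le]
    calc (b - t) * (y + C) ≤ (b - t) * (K * (2 + C)) := mul_le_mul_of_nonneg_left h1 htb
      _ = (b - t) * K * (2 + C) := by ring
      _ ≤ 2 * D * t * (2 + C) := mul_le_mul_of_nonneg_right hbt (by linarith)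
      _ = _ := by ring
  rw [expN, div_le_iff₀ ht]
  refine hsum.trans ?_
  linarith

end
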